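/- Let G be a block. Then G is K_{2,4}-minor-free if and only if one of the following holds: (i) G is outerplanar; (ii) there are two distinct vertices x and y such that G is the union of three xy-outerplanar graphs H_1, H_2, H_3 and possibly the edge xy, where |V(H_i)| ≥ 3 for each i and V(H_i) ∩ V(H_j) = {x, y} for i ≠ j; (iii) G is obtained from a 3-connected K_{2,4}-minor-free graph G_0 by choosing a (possibly empty) subdividable set of edges {x_1y_1, x_2y_2, …, x_ky_k} of G_0 and replacing each edge x_iy_i by an x_iy_i-outerplanar graph H_i (delete the edge x_iy_i and glue H_i onto the vertices x_i, y_i), where V(H_i) ∩ V(G_0) = {x_i, y_i} for each i and V(H_i) ∩ V(H_j) ⊆ V(G_0) for i ≠ j. -/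

import Mathlib

namespace K24Paper

open SimpleGraph

/-- `H` is a minor of `G`: branch sets indexed by vertices of `H`, pairwise disjoint,
each inducing a connected subgraph of `G`, with every edge of `H` realized by an edge
of `G` between the corresponding branch sets. -/
def IsMinor {W V : Type*} (H : SimpleGraph W) (G : SimpleGraph V) : Prop :=
  ∃ B : W → Set V,
    (∀ w, (G.induce (B w)).Connected) ∧
    (∀ w₁ w₂, w₁ ≠ w₂ → Disjoint (B w₁) (B w₂)) ∧
    (∀ w₁ w₂, H.Adj w₁ w₂ → ∃ v₁ ∈ B w₁, ∃ v₂ ∈ B w₂, G.Adj v₁ v₂)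

/-- `G` is `H`-minor-free. -/
def MinorFree {W V : Type*} (H : SimpleGraph W) (G : SimpleGraph V) : Prop :=
  ¬ IsMinor H G

/-- The complete bipartite graph `K_{2,4}`. -/
def K24 : SimpleGraph (Fin 2 ⊕ Fin 4) := completeBipartiteGraph (Fin 2) (Fin 4)

/-- `G` is `k`-connected: more than `k` vertices, and removing fewer than `k`
vertices leaves a connected graph. -/
def KConnected {V : Type*} (k : ℕ) (G : SimpleGraph V) : Prop :=
  k < Nat.card V ∧ ∀ S : Set V, S.ncard < k → (G.induce Sᶜ).Connected

/-- The graph `G_{n,r,s}` (with the plus edge if `plus = true`), on vertices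
`0, …, n-1` corresponding to `v_1, …, v_n`:  the spine `v_1 v_2 ⋯ v_n`, the edges
`v_1 v_{n-i}` for `1 ≤ i ≤ r`, the edges `v_n v_{1+j}` for `1 ≤ j ≤ s`, and
(if `plus`) the plus edge `v_1 v_n`. -/
def Gnrs (n r s : ℕ) (plus : Bool) : SimpleGraph (Fin n) :=
  SimpleGraph.fromRel (fun a b =>
    b.val = a.val + 1 ∨
    (a.val = 0 ∧ n - 1 - r ≤ b.val ∧ b.val ≤ n - 2) ∨
    (b.val = n - 1 ∧ 1 ≤ a.val ∧ a.val ≤ s) ∨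
    (plus = true ∧ a.val = 0 ∧ b.val = n - 1))

/-- The parameter conditions describing membership in the class `𝒢`. -/
def Gparams (n r s : ℕ) (plus : Bool) : Prop :=
  (plus = true ∧ 4 ≤ n ∧ ((r = 1 ∧ s = n - 3) ∨ (r = n - 3 ∧ s = 1))) ∨
  (5 ≤ n ∧ 2 ≤ r ∧ r ≤ n - 3 ∧ 2 ≤ s ∧ s ≤ n - 3 ∧ (r + s = n - 2 ∨ r + s = n - 1))

/-- `G` belongs to `𝒢̃`, i.e. `G` is isomorphic to a graph of the class `𝒢`. -/
def InGtilde {V : Type*} (G : SimpleGraph V) : Prop :=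
  ∃ n r s plus, Gparams n r s plus ∧ Nonempty (G ≃g Gnrs n r s plus)

/-- The graph obtained from `G` by subdividing every edge in `F` once:
new vertices are the members of `F`. -/
def SubdivideEdges {V : Type*} (G : SimpleGraph V) (F : Set (Sym2 V)) :
    SimpleGraph (V ⊕ F) :=
  SimpleGraph.fromRel (fun a b =>
    match a, b with
    | Sum.inl u, Sum.inl v => G.Adj u v ∧ s(u, v) ∉ F
    | Sum.inl u, Sum.inr e => u ∈ (e : Sym2 V)
    | Sum.inr e, Sum.inl u => u ∈ (e : Sym2 V)
    | Sum.inr _, Sum.inr _ => False)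

/-- A set `F` of edges of a graph `G` is subdividable if subdividing every edge
of `F` once yields a `K_{2,4}`-minor-free graph. -/
def Subdividable {V : Type*} (G : SimpleGraph V) (F : Set (Sym2 V)) : Prop :=
  F ⊆ G.edgeSet ∧ MinorFree K24 (SubdivideEdges G F)

/-- `F` is a maximal subdividable set of edges of `G`. -/
def MaxSubdividable {V : Type*} (G : SimpleGraph V) (F : Set (Sym2 V)) : Prop :=
  Subdividable G F ∧ ∀ F', Subdividable G F' → F ⊆ F' → F' = F

/-- `l` lists vertices along a path of `G` (consecutive entries adjacent, no repeats)
such that no two edges of `G` cross with respect to this ordering. -/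
def OuterListing {U : Type*} (G : SimpleGraph U) (l : List U) : Prop :=
  l.Nodup ∧ l.Chain' G.Adj ∧
  ∀ (i k j m : ℕ) (h1 : i < k) (h2 : k < j) (h3 : j < m) (hm : m < l.length),
    ¬(G.Adj (l.get ⟨i, by omega⟩) (l.get ⟨j, by omega⟩) ∧
      G.Adj (l.get ⟨k, by omega⟩) (l.get ⟨m, by omega⟩))

/-- The graph `G` restricted to the vertex set `A` is `xy`-outerplanar: it has a
hamilton `xy`-path (listing exactly the vertices of `A`) such that no two edges
cross with respect to it. -/
def XYOuterplanar {U : Type*} (G : SimpleGraph U) (A : Set U) (x y : U) : Prop :=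
  ∃ l : List U, (∀ v, v ∈ l ↔ v ∈ A) ∧ l.head? = some x ∧ l.getLast? = some y ∧
    OuterListing G l

/-- A block: a connected graph with no cutvertex. -/
def IsBlock {V : Type*} (G : SimpleGraph V) : Prop :=
  G.Connected ∧ ∀ v : V, (G.induce {u | u ≠ v}).Preconnected

/-- `G + xy`: the graph `G` with the edge `xy` added (if not already present). -/
def AddEdge {U : Type*} (G : SimpleGraph U) (x y : U) : SimpleGraph U :=
  G ⊔ SimpleGraph.fromRel (fun a b => a = x ∧ b = y)

/-- A standard `K_{2,t}` minor `(R₁, R₂; S)` of `G`. -/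
def StdK2tMinor {V : Type*} (G : SimpleGraph V) (t : ℕ) (R₁ R₂ S : Set V) : Prop :=
  Disjoint R₁ R₂ ∧ Disjoint (R₁ ∪ R₂) S ∧
  (G.induce R₁).Connected ∧ (G.induce R₂).Connected ∧
  S.Finite ∧ S.ncard = t ∧
  ∀ v ∈ S, (∃ w ∈ R₁, G.Adj v w) ∧ (∃ w ∈ R₂, G.Adj v w)

/-- `K_{3,3}` with parts `{0,1,2}` and `{3,4,5}`. -/
def K33 : SimpleGraph (Fin 6) :=
  SimpleGraph.fromRel (fun a b => a.val < 3 ∧ 3 ≤ b.val)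

/-- The graph `A = K_{3,3} + v₂v₃`. -/
def GA : SimpleGraph (Fin 6) := AddEdge K33 1 2

/-- The graph `A⁺ = K_{3,3} + v₂v₃ + v₅v₆`. -/
def GAplus : SimpleGraph (Fin 6) := AddEdge GA 4 5

/-- The graph `B`, on vertices `h, r₁, r₂, r₃, r₄, g₁, g₂ = 0, …, 6`. -/
def GB : SimpleGraph (Fin 7) :=
  SimpleGraph.fromRel (fun a b => (a.val, b.val) ∈
    [(0,3),(0,4),(1,4),(2,3),(3,4),(5,0),(5,1),(5,2),(6,0),(6,1),(6,2)])

/-- The graph `B⁺ = B + g₁g₂`. -/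
def GBplus : SimpleGraph (Fin 7) := AddEdge GB 5 6

/-- The graph `C⁺`, on vertices `v₁, …, v₈ = 0, …, 7`. -/
def GCplus : SimpleGraph (Fin 8) :=
  SimpleGraph.fromRel (fun a b => (a.val, b.val) ∈
    [(0,1),(0,2),(1,2),(3,4),(3,5),(3,6),(3,7),(4,5),(4,6),(4,7),(2,5),(1,7),(0,6)])

/-- The graph `C = C⁺ ∖ v₄v₅`. -/
def GC : SimpleGraph (Fin 8) := GCplus.deleteEdges {s(3, 4)}

/-- The graph `D`, on vertices `t₁, t₂, t₃, d₁, d₂, d₃, g = 0, …, 6`. -/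
def GD : SimpleGraph (Fin 7) :=
  SimpleGraph.fromRel (fun a b => (a.val, b.val) ∈
    [(0,1),(0,2),(1,2),(3,4),(3,5),(4,5),(0,3),(1,4),(2,5),(6,0),(6,1),(6,2)])

/-- The complete graph `K₅`. -/
def GK5 : SimpleGraph (Fin 5) := completeGraph (Fin 5)

end K24Paper

namespace K24Paper

open SimpleGraph
open SimpleGraph

/-! ### Part 1: connectivity of vertex sets in cut form -/

section Basics
variable {V : Type*} {G G' : SimpleGraph V}

/-- `P` is closed under `G`-adjacency inside `S`. -/
def Clo (G : SimpleGraph V) (S P : Set V) : Prop :=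
  ∀ u ∈ P, ∀ w ∈ S, G.Adj u w → w ∈ P

/-- Cut form of connectedness of a vertex set. -/
def Conn (G : SimpleGraph V) (S : Set V) : Prop :=
  S.Nonempty ∧ ∀ P : Set V, P ⊆ S → P.Nonempty → Clo G S P → S ⊆ P

/-- Component of a vertex set. -/
def IsComp (G : SimpleGraph V) (S D : Set V) : Prop :=
  D ⊆ S ∧ Conn G D ∧ Clo G S D

theorem Conn.sub (h : Conn G S) (P : Set V) (hne : ∃ a ∈ S, a ∈ P)
    (hc : ∀ u ∈ S, ∀ w ∈ S, G.Adj u w → u ∈ P → w ∈ P) : S ⊆ P := by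
  have := h.2 (P ∩ S) Set.inter_subset_right
    (by obtain ⟨a, h1, h2⟩ := hne; exact ⟨a, h2, h1⟩)
    (by intro u hu w hw huw; exact ⟨hc u hu.2 w hw huw hu.1, hw⟩)
  exact fun a ha => (this ha).1

theorem conn_of (S : Set V) (hS : S.Nonempty)
    (h : ∀ P : Set V, (∃ a ∈ S, a ∈ P) → (∀ u ∈ S, ∀ w ∈ S, G.Adj u w → u ∈ P → w ∈ P) → S ⊆ P) :
    Conn G S :=
  ⟨hS, fun P hPS ⟨a, ha⟩ hc => h P ⟨a, hPS ha, ha⟩ (fun u _ w hw huw hu => hc u hu w hw huw)⟩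

/-- It suffices that each closed set contains a base point. -/
theorem conn_of_base (S : Set V) (c : V) (hc : c ∈ S)
    (h : ∀ P : Set V, P ⊆ S → P.Nonempty → Clo G S P → c ∈ P) : Conn G S := by
  refine ⟨⟨c, hc⟩, fun P hPS hP hcl a ha => ?_⟩
  by_contra hn
  have := h (S \ P) Set.sdiff_subset ⟨a, ha, hn⟩ (by
    intro u hu w hw huw
    refine ⟨hw, fun hwP => hu.2 (hcl w hwP u hu.1 huw.symm)⟩)
  exact this.2 (h P hPS hP hcl)

theorem induce_connected_iff (S : Set V) : (G.induce S).Connected ↔ Conn G S := by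
  constructor
  · intro h
    obtain ⟨⟨a, ha⟩⟩ := h.nonempty
    refine conn_of_base S a ha fun P hPS ⟨b, hb⟩ hcl => ?_
    have hr := h.preconnected ⟨b, hPS hb⟩ ⟨a, ha⟩
    rw [SimpleGraph.reachable_iff_reflTransGen] at hr
    have : ∀ z : S, Relation.ReflTransGen (G.induce S).Adj ⟨b, hPS hb⟩ z → (z : V) ∈ P := by
      intro z hz
      induction hz with
      | refl => exact hb
      | tail _ h2 ih => exact hcl _ ih _ (Subtype.property _) h2
    exact this _ hr
  · intro h
    obtain ⟨a, ha⟩ := h.1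
    have : Nonempty S := ⟨⟨a, ha⟩⟩
    refine SimpleGraph.Connected.mk ?_
    intro u v
    have := h.sub {w | ∃ hw : w ∈ S, (G.induce S).Reachable u ⟨w, hw⟩} ⟨u, u.2, u.2, by rfl⟩ (by
      rintro p hp w hw hpw ⟨_, hr⟩
      refine ⟨hw, hr.trans ?_⟩
      exact SimpleGraph.Adj.reachable (by simpa using hpw))
    obtain ⟨_, hr⟩ := this v.2
    exact hr

theorem Conn.mono (h : Conn G S) (hle : ∀ u ∈ S, ∀ w ∈ S, G.Adj u w → G'.Adj u w) : Conn G' S :=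
  conn_of S h.1 fun P hne hc => h.sub P hne fun u hu w hw huw => hc u hu w hw (hle u hu w hw huw)

theorem conn_singleton (a : V) : Conn G {a} :=
  conn_of_base {a} a rfl fun P hP ⟨b, hb⟩ _ => by
    have := hP hb; simp at this; exact this ▸ hb

theorem Conn.union {S T : Set V} (hS : Conn G S) (hT : Conn G T)
    (h : ∃ a, a ∈ S ∧ a ∈ T) : Conn G (S ∪ T) := by
  obtain ⟨a, haS, haT⟩ := h
  refine conn_of_base _ a (Or.inl haS) fun P hP ⟨b, hb⟩ hcl => ?_
  rcases hP hb with h1 | h1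
  · exact hS.sub P ⟨b, h1, hb⟩ (fun u hu w hw huw hp => hcl u hp w (Or.inl hw) huw) haS
  · exact hT.sub P ⟨b, h1, hb⟩ (fun u hu w hw huw hp => hcl u hp w (Or.inr hw) huw) haT

theorem Conn.union_adj {S T : Set V} (hS : Conn G S) (hT : Conn G T)
    (h : ∃ a ∈ S, ∃ b ∈ T, G.Adj a b) : Conn G (S ∪ T) := by
  obtain ⟨a, haS, b, hbT, hab⟩ := h
  refine conn_of_base _ a (Or.inl haS) fun P hP ⟨d, hd⟩ hcl => ?_
  rcases hP hd with h1 | h1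
  · exact hS.sub P ⟨d, h1, hd⟩ (fun u hu w hw huw hp => hcl u hp w (Or.inl hw) huw) haS
  · exact hcl b (hT.sub P ⟨d, h1, hd⟩ (fun u hu w hw huw hp => hcl u hp w (Or.inr hw) huw) hbT)
      a (Or.inl haS) hab.symm

theorem Conn.insert1 {S : Set V} (hS : Conn G S) (a : V) (h : ∃ b ∈ S, G.Adj a b) :
    Conn G (insert a S) := by
  rw [Set.insert_eq]
  exact (conn_singleton a).union_adj hS (by obtain ⟨b, hb, hab⟩ := h; exact ⟨a, rfl, b, hb, hab⟩)

/-- Removing a part attached only at `c` keeps connectedness. -/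
theorem Conn.diff {K D : Set V} (hK : Conn G K) (c : V) (hc : c ∈ K) (hcD : c ∉ D)
    (hD : ∀ u ∈ D, ∀ w ∈ K, G.Adj u w → w ∈ D ∨ w = c) : Conn G (K \ D) := by
  refine conn_of_base _ c ⟨hc, hcD⟩ fun P hP ⟨b, hb⟩ hcl => ?_
  by_contra hcP
  refine hcP (hK.sub P ⟨b, (hP hb).1, hb⟩ (fun u hu w hw huw hp => ?_) hc)
  by_cases hwD : w ∈ D
  · rcases hD w hwD u hu huw.symm with h | h
    · exact absurd h (hP hp).2
    · exact absurd (h ▸ hp) hcP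
  · exact hcl u hp w ⟨hw, hwD⟩ huw

/-- Keeping a part attached only at `c`, together with `c`, keeps connectedness. -/
theorem Conn.part {K D : Set V} (hK : Conn G K) (c : V) (hc : c ∈ K)
    (hD : ∀ u ∈ D, ∀ w ∈ K, G.Adj u w → w ∈ D ∨ w = c) : Conn G (K ∩ (insert c D)) := by
  refine conn_of_base _ c ⟨hc, Or.inl rfl⟩ fun P hP ⟨b, hb⟩ hcl => ?_
  by_contra hcP
  refine hcP (hK.sub P ⟨b, (hP hb).1, hb⟩ (fun u hu w hw huw hp => ?_) hc)
  rcases (hP hp).2 with h | h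
  · exact absurd (h ▸ hp) hcP
  · rcases hD u h w hw huw with h' | h'
    · exact hcl u hp w ⟨hw, Or.inr h'⟩ huw
    · exact hcl u hp w ⟨hw, Or.inl h'⟩ huw

theorem Conn.sub_of_clo {K S D : Set V} (hK : Conn G K) (hKS : K ⊆ S) (hD : Clo G S D)
    (h : ∃ a ∈ K, a ∈ D) : K ⊆ D :=
  hK.sub D h fun u _ w hw huw hp => hD u hp w (hKS hw) huw

/-- A connected set with a proper nonempty part has an edge leaving this part. -/
theorem Conn.exit {K D : Set V} (hK : Conn G K) (h : ∃ a ∈ K, a ∈ D) (h' : ∃ b ∈ K, b ∉ D) :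
    ∃ u ∈ K, u ∈ D ∧ ∃ w ∈ K, w ∉ D ∧ G.Adj u w := by
  by_contra hn
  push Not at hn
  obtain ⟨b, hb, hbD⟩ := h'
  refine hbD (hK.sub D h (fun u hu w hw huw hp => ?_) hb)
  by_contra hwD
  exact hn u hu hp w hw hwD huw

theorem exists_comp (S : Set V) (v : V) (hv : v ∈ S) : ∃ D, IsComp G S D ∧ v ∈ D := by
  let D : Set V := {u | ∀ P : Set V, v ∈ P → Clo G S P → u ∈ P}
  have hvD : v ∈ D := fun P h _ => h
  have hDS : D ⊆ S := fun u hu => hu S hv (fun _ _ w hw _ => hw)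
  have hcl : Clo G S D := fun u hu w hw huw P hP hc => hc u (hu P hP hc) w hw huw
  refine ⟨D, ⟨hDS, ?_, hcl⟩, hvD⟩
  refine conn_of_base D v hvD fun P hP ⟨a, ha⟩ hc => ?_
  by_contra hvP
  have : a ∈ D \ P := hP ha (D \ P) ⟨hvD, hvP⟩ (by
    intro u hu w hw huw
    have hwD := hcl u hu.1 w hw huw
    exact ⟨hwD, fun hwP => hu.2 (hc w hwP u hu.1 huw.symm)⟩)
  exact this.2 ha

theorem exists_comp_in {S P : Set V} (hPS : P ⊆ S) (hP : P.Nonempty) (hcl : Clo G S P) :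
    ∃ D, IsComp G S D ∧ D ⊆ P := by
  obtain ⟨v, hv⟩ := hP
  obtain ⟨D, hD, hvD⟩ := exists_comp (G := G) S v (hPS hv)
  exact ⟨D, hD, hD.2.1.sub_of_clo hD.1 hcl ⟨v, hvD, hv⟩⟩

theorem IsComp.eq_of_meet {S D D' : Set V} (h : IsComp G S D) (h' : IsComp G S D')
    (hm : ∃ a ∈ D, a ∈ D') : D = D' :=
  Set.Subset.antisymm (h.2.1.sub_of_clo h.1 h'.2.2 hm)
    (h'.2.1.sub_of_clo h'.1 h.2.2 (by obtain ⟨a, h1, h2⟩ := hm; exact ⟨a, h2, h1⟩))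

/-- A path segment is connected. -/
theorem conn_seg (u : ℕ → V) (i j : ℕ) (hij : i ≤ j) (h : ∀ t, i ≤ t → t < j → G.Adj (u t) (u (t+1))) :
    Conn G (u '' Set.Icc i j) := by
  induction j, hij using Nat.le_induction with
  | base => simpa using conn_singleton (G := G) (u i)
  | succ j hij ih =>
    have := (ih (fun t h1 h2 => h t h1 (by omega))).insert1 (u (j+1))
      ⟨u j, ⟨j, ⟨hij, le_rfl⟩, rfl⟩, (h j hij (by omega)).symm⟩
    have e : u '' Set.Icc i (j+1) = insert (u (j+1)) (u '' Set.Icc i j) := by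
      ext v; constructor
      · rintro ⟨t, ⟨h1, h2⟩, rfl⟩
        by_cases ht : t = j + 1
        · left; rw [ht]
        · right; exact ⟨t, ⟨h1, by omega⟩, rfl⟩
      · rintro (rfl | ⟨t, ⟨h1, h2⟩, rfl⟩)
        · exact ⟨j+1, ⟨by omega, le_rfl⟩, rfl⟩
        · exact ⟨t, ⟨h1, by omega⟩, rfl⟩
    rw [e]; exact this

/-- Sets joined by an edge. -/
def Tch (G : SimpleGraph V) (S T : Set V) : Prop := ∃ a ∈ S, ∃ b ∈ T, G.Adj a b

theorem Tch.symm {S T : Set V} (h : Tch G S T) : Tch G T S := by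
  obtain ⟨a, ha, b, hb, hab⟩ := h; exact ⟨b, hb, a, ha, hab.symm⟩

theorem Tch.mono {S T S' T' : Set V} (h : Tch G S T) (hS : S ⊆ S') (hT : T ⊆ T') : Tch G S' T' := by
  obtain ⟨a, ha, b, hb, hab⟩ := h; exact ⟨a, hS ha, b, hT hb, hab⟩

/-- Cut form of the block property. -/
theorem IsBlock.cut (hG : IsBlock G) (c : V) (P : Set V) (hcP : c ∉ P) (hP : P.Nonempty)
    (hcl : Clo G {c}ᶜ P) (v : V) (hv : v ≠ c) : v ∈ P := by
  obtain ⟨a, ha⟩ := hP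
  have hac : a ≠ c := fun h => hcP (h ▸ ha)
  have hr := hG.2 c ⟨a, hac⟩ ⟨v, hv⟩
  have : Nonempty {u | u ≠ c} := ⟨⟨a, hac⟩⟩
  have hconn := (induce_connected_iff (G := G) {u | u ≠ c}).1 ⟨hG.2 c⟩
  exact hconn.sub P ⟨a, hac, ha⟩ (fun u _ w hw huw hp => hcl u hp w hw huw) hv

theorem IsBlock.univ (hG : IsBlock G) : Conn G Set.univ := by
  obtain ⟨a⟩ := hG.1.nonempty
  refine conn_of_base _ a trivial fun P _ ⟨b, hb⟩ hcl => ?_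
  have hr := hG.1.preconnected b a
  rw [SimpleGraph.reachable_iff_reflTransGen] at hr
  induction hr with
  | refl => exact hb
  | tail _ h2 ih => exact hcl _ ih _ trivial h2

end Basics

/-! ### Minors -/
section Minors
variable {W V V' : Type*} {H : SimpleGraph W} {G G' : SimpleGraph V}

theorem isMinor_iff : IsMinor H G ↔ ∃ B : W → Set V, (∀ w, Conn G (B w)) ∧
    (∀ w₁ w₂ v, v ∈ B w₁ → v ∈ B w₂ → w₁ = w₂) ∧ (∀ w₁ w₂, H.Adj w₁ w₂ → Tch G (B w₁) (B w₂)) := by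
  unfold IsMinor Tch
  simp only [induce_connected_iff]
  refine exists_congr fun B => and_congr Iff.rfl (and_congr ?_ Iff.rfl)
  refine forall_congr' fun w₁ => forall_congr' fun w₂ => ?_
  rw [Set.disjoint_left]
  constructor
  · intro h v h1 h2; by_contra hne; exact h hne h1 h2
  · intro h hne v h1 h2; exact hne (h v h1 h2)

theorem IsMinor.mono (h : IsMinor H G) (hle : G ≤ G') : IsMinor H G' := by
  rw [isMinor_iff] at h ⊢
  obtain ⟨B, h1, h2, h3⟩ := h
  refine ⟨B, fun w => (h1 w).mono fun _ _ _ _ hh => hle hh, h2, fun a b hab => ?_⟩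
  obtain ⟨p, hp, q, hq, hpq⟩ := h3 a b hab
  exact ⟨p, hp, q, hq, hle hpq⟩

/-- every vertex of a branch set has a neighbour -/
theorem noniso {B : W → Set V} (h1 : ∀ w, Conn G (B w))
    (h2 : ∀ w₁ w₂ v, v ∈ B w₁ → v ∈ B w₂ → w₁ = w₂)
    (h3 : ∀ w₁ w₂, H.Adj w₁ w₂ → Tch G (B w₁) (B w₂)) (hH : ∀ w, ∃ w', H.Adj w w')
    (w : W) (v : V) (hv : v ∈ B w) : ∃ v', G.Adj v v' := by
  by_cases hs : ∃ b ∈ B w, b ∉ ({v} : Set V)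
  · obtain ⟨u, _, hu, z, _, _, huz⟩ := (h1 w).exit (D := {v}) ⟨v, hv, rfl⟩ hs
    cases hu; exact ⟨z, huz⟩
  · push Not at hs
    obtain ⟨w', hw'⟩ := hH w
    obtain ⟨a, ha, b, hb, hab⟩ := h3 w w' hw'
    have := hs a ha
    cases this; exact ⟨b, hab⟩

theorem IsMinor.trans' {G' : SimpleGraph V'} (h : IsMinor H G) (hH : ∀ w, ∃ w', H.Adj w w')
    (C : V → Set V') (hd : ∀ a b v, v ∈ C a → v ∈ C b → a = b)
    (hc : ∀ a b, G.Adj a b → Conn G' (C a)) (he : ∀ a b, G.Adj a b → Tch G' (C a) (C b)) :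
    IsMinor H G' := by
  rw [isMinor_iff] at h ⊢
  obtain ⟨B, h1, h2, h3⟩ := h
  have hn := noniso h1 h2 h3 hH
  refine ⟨fun w => {z | ∃ v ∈ B w, z ∈ C v}, fun w => ?_, ?_, ?_⟩
  · obtain ⟨v0, hv0⟩ := (h1 w).1
    obtain ⟨v0', hv0'⟩ := hn w v0 hv0
    obtain ⟨z0, hz0⟩ := (hc v0 v0' hv0').1
    refine conn_of _ ⟨z0, v0, hv0, hz0⟩ fun P hP hcl => ?_
    have key : ∀ v ∈ B w, (∃ z ∈ C v, z ∈ P) → C v ⊆ P := fun v hv hz => by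
      obtain ⟨v', hv'⟩ := hn w v hv
      exact (hc v v' hv').sub P hz fun p hp q hq hpq => hcl p ⟨v, hv, hp⟩ q ⟨v, hv, hq⟩ hpq
    have := (h1 w).sub {v | C v ⊆ P} (by
      obtain ⟨z, ⟨v, hv, hz⟩, hzP⟩ := hP
      exact ⟨v, hv, key v hv ⟨z, hz, hzP⟩⟩) (by
      intro u hu v hv huv hup
      obtain ⟨p, hp, q, hq, hpq⟩ := he u v huv
      exact key v hv ⟨q, hq, hcl p ⟨u, hu, hp⟩ q ⟨v, hv, hq⟩ hpq (hup hp)⟩)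
    rintro z ⟨v, hv, hz⟩
    exact this hv hz
  · rintro w₁ w₂ z ⟨v, hv, hz⟩ ⟨v', hv', hz'⟩
    cases hd v v' z hz hz'
    exact h2 _ _ _ hv hv'
  · intro w₁ w₂ hw
    obtain ⟨p, hp, q, hq, hpq⟩ := h3 w₁ w₂ hw
    obtain ⟨a, ha, b, hb, hab⟩ := he p q hpq
    exact ⟨a, ⟨p, hp, ha⟩, b, ⟨q, hq, hb⟩, hab⟩

/-- Cardinality obstruction. -/
theorem not_isMinor_of_card [Fintype W] (hH : ∀ w, ∃ w', H.Adj w w') (S : Finset V)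
    (hS : ∀ u v, G.Adj u v → u ∈ S) (hcard : S.card < Fintype.card W) : ¬ IsMinor H G := by
  intro h
  rw [isMinor_iff] at h
  obtain ⟨B, h1, h2, h3⟩ := h
  have hn := noniso h1 h2 h3 hH
  choose f hf using fun w => (h1 w).1
  have hinj : Function.Injective f := fun a b hab => h2 a b (f a) (hf a) (hab ▸ hf b)
  have : Fintype.card W ≤ S.card := by
    rw [← Finset.card_univ]
    refine Finset.card_le_card_of_injOn f (fun w _ => ?_) hinj.injOn
    obtain ⟨v', hv'⟩ := hn w (f w) (hf w)
    exact hS _ _ hv'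
  omega

end Minors

open SimpleGraph

/-! ### Part 2: reduction operations preserving minors -/

section Ops
variable {W V : Type*} {H : SimpleGraph W} {G : SimpleGraph V}

/-- Graphs with minimum degree at least two, in which a vertex of degree two lies in no
triangle and has no neighbour of degree two. -/
def Nice (H : SimpleGraph W) : Prop :=
  ∀ w a b, (∀ c, H.Adj w c → c = a ∨ c = b) →
    a ≠ b ∧ ¬ H.Adj a b ∧ ∀ d, ¬ ∀ c, H.Adj a c → c = w ∨ c = d

theorem Nice.noniso (hH : Nice H) (w : W) : ∃ w', H.Adj w w' := by
  by_contra hn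
  push Not at hn
  exact (hH w w w (fun c hc => absurd hc (hn c))).1 rfl

/-- A model of `H` in `G`. -/
def Model (H : SimpleGraph W) (G : SimpleGraph V) (B : W → Set V) : Prop :=
  (∀ w, Conn G (B w)) ∧ (∀ w₁ w₂ v, v ∈ B w₁ → v ∈ B w₂ → w₁ = w₂) ∧
    (∀ w₁ w₂, H.Adj w₁ w₂ → Tch G (B w₁) (B w₂))

theorem op1_core {B : W → Set V} (hB : Model H G B) {h x y : V} {w : W}
    (hx : G.Adj h x) (hy : G.Adj h y) (hh : h ∈ B w) (hxw : x ∈ B w) :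
    Model H (G.deleteEdges {s(x, y)}) B := by
  obtain ⟨h1, h2, h3⟩ := hB
  have hx' : (G.deleteEdges {s(x, y)}).Adj h x := by
    rw [SimpleGraph.deleteEdges_adj]
    refine ⟨hx, ?_⟩
    have := hx.ne; have := hy.ne
    simp; grind
  have hy' : (G.deleteEdges {s(x, y)}).Adj h y := by
    rw [SimpleGraph.deleteEdges_adj]
    refine ⟨hy, ?_⟩
    have := hx.ne; have := hy.ne
    simp; grind
  have hd : ∀ u v, G.Adj u v → ¬ (u = x ∧ v = y) → ¬ (u = y ∧ v = x) →
      (G.deleteEdges {s(x, y)}).Adj u v := by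
    intro u v huv ha hb
    rw [SimpleGraph.deleteEdges_adj]
    refine ⟨huv, ?_⟩
    simp; tauto
  refine ⟨fun v => ?_, h2, fun w₁ w₂ hw => ?_⟩
  · refine conn_of _ (h1 v).1 fun P hP hcl => (h1 v).sub P hP fun p hp q hq hpq hpP => ?_
    by_cases ha : p = x ∧ q = y
    · obtain ⟨rfl, rfl⟩ := ha
      cases h2 _ _ _ hp hxw
      exact hcl h hh _ hq hy' (hcl _ hp h hh hx'.symm hpP)
    · by_cases hb : p = y ∧ q = x
      · obtain ⟨rfl, rfl⟩ := hb
        cases h2 _ _ _ hq hxw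
        exact hcl h hh _ hq hx' (hcl _ hp h hh hy'.symm hpP)
      · exact hcl p hp q hq (hd p q hpq ha hb) hpP
  · obtain ⟨p, hp, q, hq, hpq⟩ := h3 w₁ w₂ hw
    by_cases ha : p = x ∧ q = y
    · obtain ⟨rfl, rfl⟩ := ha
      cases h2 _ _ _ hp hxw
      exact ⟨h, hh, q, hq, hy'⟩
    · by_cases hb : p = y ∧ q = x
      · obtain ⟨rfl, rfl⟩ := hb
        cases h2 _ _ _ hq hxw
        exact ⟨p, hp, h, hh, hy'.symm⟩
      · exact ⟨p, hp, q, hq, hd p q hpq ha hb⟩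

theorem model_del {B : W → Set V} (hB : Model H G B) {x y : V}
    (hxy : ∀ a b, x ∈ B a → y ∈ B b → a ≠ b ∧ ¬ H.Adj a b) :
    Model H (G.deleteEdges {s(x, y)}) B := by
  obtain ⟨h1, h2, h3⟩ := hB
  have hd : ∀ u v, G.Adj u v → ¬ (u = x ∧ v = y) → ¬ (u = y ∧ v = x) →
      (G.deleteEdges {s(x, y)}).Adj u v := by
    intro u v huv ha hb
    rw [SimpleGraph.deleteEdges_adj]
    refine ⟨huv, ?_⟩
    simp; tauto
  refine ⟨fun v => (h1 v).mono fun p hp q hq hpq => hd p q hpq ?_ ?_, h2, fun w₁ w₂ hw => ?_⟩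
  · rintro ⟨rfl, rfl⟩; exact (hxy v v hp hq).1 rfl
  · rintro ⟨rfl, rfl⟩; exact (hxy v v hq hp).1 rfl
  · obtain ⟨p, hp, q, hq, hpq⟩ := h3 w₁ w₂ hw
    refine ⟨p, hp, q, hq, hd p q hpq ?_ ?_⟩
    · rintro ⟨rfl, rfl⟩; exact (hxy _ _ hp hq).2 hw
    · rintro ⟨rfl, rfl⟩; exact (hxy _ _ hq hp).2 hw.symm

/-- A branch set all of whose vertices ... is a singleton. -/
theorem eq_singleton_of {S : Set V} (hS : Conn G S) {h : V} (hh : h ∈ S)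
    (hn : ∀ v ∈ S, ¬ G.Adj h v) : S = {h} := by
  refine Set.Subset.antisymm (hS.sub {h} ⟨h, hh, rfl⟩ ?_) (by simpa using hh)
  rintro u _ w hw huw rfl
  exact absurd huw (hn w hw)

theorem op1 (hH : Nice H) {h x y : V} (hx : G.Adj h x) (hy : G.Adj h y)
    (hN : ∀ v, G.Adj h v → v = x ∨ v = y) (hm : IsMinor H G) :
    IsMinor H (G.deleteEdges {s(x, y)}) := by
  rw [isMinor_iff] at hm ⊢
  obtain ⟨B, hB⟩ := hm
  change Model H G B at hB
  change ∃ B, Model H (G.deleteEdges {s(x, y)}) B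
  by_cases hxB : ∃ w, x ∈ B w
  swap
  · exact ⟨B, model_del hB fun a b ha _ => absurd ⟨a, ha⟩ hxB⟩
  obtain ⟨w, hxw⟩ := hxB
  by_cases hhB : ∃ w0, h ∈ B w0
  · obtain ⟨w0, hw0⟩ := hhB
    by_cases hx0 : x ∈ B w0
    · exact ⟨B, op1_core hB hx hy hw0 hx0⟩
    by_cases hy0 : y ∈ B w0
    · rw [Sym2.eq_swap]
      exact ⟨B, op1_core hB hy hx hw0 hy0⟩
    have hs : B w0 = {h} := eq_singleton_of (hB.1 w0) hw0 (by
      intro v hv hadj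
      rcases hN v hadj with rfl | rfl <;> contradiction)
    refine ⟨B, model_del hB fun a b ha hb => ?_⟩
    have := hH w0 a b (fun c hc => ?_)
    · exact ⟨this.1, this.2.1⟩
    · obtain ⟨p, hp, q, hq, hpq⟩ := hB.2.2 w0 c hc
      rw [hs] at hp
      cases hp
      rcases hN q hpq with rfl | rfl
      · left; exact hB.2.1 _ _ _ hq ha
      · right; exact hB.2.1 _ _ _ hq hb
  · push Not at hhB
    obtain ⟨h1, h2, h3⟩ := hB
    classical
    have hsub : ∀ v, B v ⊆ Function.update B w (insert h (B w)) v := by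
      intro v
      by_cases hv : v = w
      · subst hv; simp
      · simp [hv]
    have hB' : Model H G (Function.update B w (insert h (B w))) := by
      refine ⟨fun v => ?_, ?_, fun w₁ w₂ hw => (h3 w₁ w₂ hw).mono (hsub _) (hsub _)⟩
      · by_cases hv : v = w
        · subst hv; simp only [Function.update_self]
          exact (h1 v).insert1 h ⟨x, hxw, hx⟩
        · simpa [hv] using h1 v
      · intro a b v ha hb
        by_cases h5 : a = w <;> by_cases h6 : b = w <;> simp [Function.update_apply, h5, h6] at ha hb ⊢
        · rcases ha with rfl | ha
          · exact absurd hb (hhB b)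
          · exact h2 _ _ _ ha hb
        · rcases hb with rfl | hb
          · exact absurd ha (hhB a)
          · exact absurd (h2 _ _ _ ha hb) h5
        · exact h2 _ _ _ ha hb
    exact ⟨_, op1_core hB' (w := w) hx hy (by simp) (hsub w hxw)⟩

/-- Suppress `h` (isolating it) and join `h'` to `q`. -/
def supp (G : SimpleGraph V) (h h' q : V) : SimpleGraph V where
  Adj s t := s ≠ t ∧ ((G.Adj s t ∧ s ≠ h ∧ t ≠ h) ∨ (s = h' ∧ t = q) ∨ (s = q ∧ t = h'))
  symm := ⟨by
    rintro s t ⟨h0, h1⟩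
    refine ⟨h0.symm, ?_⟩
    rcases h1 with ⟨h1, h2, h3⟩ | h1 | h1
    · exact Or.inl ⟨h1.symm, h3, h2⟩
    · tauto
    · tauto⟩
  loopless := ⟨fun s hs => hs.1 rfl⟩

theorem op2 (hH : Nice H) {h h' p q : V} (hhh : G.Adj h h') (hhq : G.Adj h q) (hhp : G.Adj h' p)
    (hph : p ≠ h) (hqh : q ≠ h')
    (hN : ∀ v, G.Adj h v → v = h' ∨ v = q) (hN' : ∀ v, G.Adj h' v → v = h ∨ v = p)
    (hm : IsMinor H G) : IsMinor H (supp G h h' q) := by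
  rw [isMinor_iff] at hm ⊢
  obtain ⟨B, h1, h2, h3⟩ := hm
  have hq' : (supp G h h' q).Adj h' q := ⟨hqh.symm, by tauto⟩
  have hkeep : ∀ u v, G.Adj u v → u ≠ h → v ≠ h → (supp G h h' q).Adj u v :=
    fun u v huv hu hv => ⟨huv.ne, Or.inl ⟨huv, hu, hv⟩⟩
  by_cases hs : ∃ w, B w = {h}
  · -- singleton branch set
    obtain ⟨w, hw⟩ := hs
    have hhw : h ∈ B w := by simp [hw]
    have hNw : ∀ c, H.Adj w c → h' ∈ B c ∨ q ∈ B c := by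
      intro c hc
      obtain ⟨s, hs, t, ht, hst⟩ := h3 w c hc
      rw [hw] at hs; cases hs
      rcases hN t hst with rfl | rfl
      · exact Or.inl ht
      · exact Or.inr ht
    have hb : ∃ b, q ∈ B b := by
      by_contra hn
      push Not at hn
      obtain ⟨c, hc⟩ := hH.noniso w
      have hc' := (hNw c hc).resolve_right (hn c)
      exact (hH w c c fun d hd => Or.inl (h2 _ _ _ ((hNw d hd).resolve_right (hn d)) hc')).1 rfl
    have ha : ∃ a, h' ∈ B a := by
      by_contra hn
      push Not at hn
      obtain ⟨c, hc⟩ := hH.noniso w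
      have hc' := (hNw c hc).resolve_left (hn c)
      exact (hH w c c fun d hd => Or.inl (h2 _ _ _ ((hNw d hd).resolve_left (hn d)) hc')).1 rfl
    obtain ⟨a, ha⟩ := ha
    obtain ⟨b, hb⟩ := hb
    have hnice := hH w a b fun c hc => (hNw c hc).imp (fun h => h2 _ _ _ h ha) (fun h => h2 _ _ _ h hb)
    obtain ⟨hab, hnab, hdeg⟩ := hnice
    have hne : h' ≠ h := hhh.ne.symm
    have haw : a ≠ w := by
      rintro rfl; rw [hw] at ha; exact hne ha
    have hha : h ∉ B a := fun hc => haw (h2 _ _ _ hc hhw)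
    have hpa : p ∈ B a := by
      by_contra hp
      have hsing : B a = {h'} := eq_singleton_of (h1 a) ha (by
        intro v hv hadj
        rcases hN' v hadj with rfl | rfl <;> contradiction)
      have hna : ∀ c, H.Adj a c → h ∈ B c ∨ p ∈ B c := by
        intro c hc
        obtain ⟨s, hs, t, ht, hst⟩ := h3 a c hc
        rw [hsing] at hs; cases hs
        rcases hN' t hst with rfl | rfl
        · exact Or.inl ht
        · exact Or.inr ht
      by_cases hd : ∃ d, p ∈ B d
      · obtain ⟨d, hd⟩ := hd
        exact hdeg d fun c hc => (hna c hc).imp (fun h => h2 _ _ _ h hhw) (fun h => h2 _ _ _ h hd)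
      · push Not at hd
        exact hdeg w fun c hc => Or.inl (h2 _ _ _ ((hna c hc).resolve_right (hd c)) hhw)
    have hpne : p ≠ h' := hhp.ne.symm
    classical
    let B' : W → Set V := fun v => if v = w then {h'} else B v \ {h'}
    have hB'w : B' w = {h'} := by simp [B']
    have hB'a : B' a = B a \ {h'} := by simp [B', haw]
    have hB' : ∀ v, v ≠ w → v ≠ a → B' v = B v := by
      intro v hv hva
      simp only [B', hv, if_false]
      ext z; simp only [Set.mem_diff, Set.mem_singleton_iff, and_iff_left_iff_imp]
      rintro hz rfl
      exact hva (h2 _ _ _ hz ha)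
    have hcore : ∀ v z, v ≠ w → z ∈ B v → z ≠ h := by
      rintro v z hv hz rfl; exact hv (h2 _ _ _ hz hhw)
    refine ⟨B', fun v => ?_, ?_, ?_⟩
    · by_cases hv : v = w
      · subst hv; rw [hB'w]; exact conn_singleton _
      by_cases hva : v = a
      · subst hva; rw [hB'a]
        refine Conn.mono (G := G) ((h1 v).diff p hpa (by simpa using hpne) ?_) ?_
        · rintro u hu z hz huz
          cases hu
          rcases hN' z huz with rfl | rfl
          · exact absurd hz hha
          · exact Or.inr rfl
        · intro s hs t ht hst
          exact hkeep s t hst (hcore v s hv hs.1) (hcore v t hv ht.1)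
      · rw [hB' v hv hva]
        exact (h1 v).mono fun s hs t ht hst => hkeep s t hst (hcore v s hv hs) (hcore v t hv ht)
    · intro c d z hc hd
      simp only [B'] at hc hd
      by_cases h5 : c = w <;> by_cases h6 : d = w <;> simp [h5, h6] at hc hd ⊢
      · exact absurd hc hd.2
      · exact absurd hd hc.2
      · exact h2 _ _ _ hc.1 hd.1
    · have main : ∀ c d, c ≠ w → d ≠ w → H.Adj c d → Tch (supp G h h' q) (B' c) (B' d) := by
        intro c d hc hd hcd
        obtain ⟨s, hs, t, ht, hst⟩ := h3 c d hcd
        have hsh := hcore c s hc hs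
        have hth := hcore d t hd ht
        refine ⟨s, ?_, t, ?_, hkeep s t hst hsh hth⟩
        · simp only [B', hc, if_false]
          refine ⟨hs, ?_⟩
          rintro rfl
          rcases hN' t hst with rfl | rfl
          · exact hth rfl
          · exact hcd.ne ((h2 _ _ _ hs ha).trans (h2 _ _ _ ht hpa).symm)
        · simp only [B', hd, if_false]
          refine ⟨ht, ?_⟩
          rintro rfl
          rcases hN' s hst.symm with rfl | rfl
          · exact hsh rfl
          · exact hcd.ne ((h2 _ _ _ hs hpa).trans (h2 _ _ _ ht ha).symm)
      have mainw : ∀ d, H.Adj w d → Tch (supp G h h' q) (B' w) (B' d) := by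
        intro d hd
        rcases hNw d hd with h5 | h5
        · cases h2 _ _ _ h5 ha
          rw [hB'w, hB'a]
          exact ⟨h', rfl, p, ⟨hpa, by simpa using hpne⟩, hkeep _ _ hhp hne hph⟩
        · rw [hB'w]
          refine ⟨h', rfl, q, ?_, hq'⟩
          simp only [B', hd.ne.symm, if_false]
          exact ⟨h5, by simpa using hqh⟩
      intro c d hcd
      by_cases hc : c = w
      · subst hc; exact mainw d hcd
      by_cases hd : d = w
      · subst hd; exact (mainw c hcd.symm).symm
      exact main c d hc hd hcd
  · push Not at hs
    have hother : ∀ w, h ∈ B w → h' ∈ B w ∨ q ∈ B w := by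
      intro w hw
      by_contra hn
      push Not at hn
      exact hs w (eq_singleton_of (h1 w) hw (by
        intro v hv hadj
        rcases hN v hadj with rfl | rfl
        · exact hn.1 hv
        · exact hn.2 hv))
    have hne : h' ≠ h := hhh.ne.symm
    have hqne : q ≠ h := hhq.ne.symm
    refine ⟨fun w => B w \ {h}, fun w => ?_, fun a b v ha hb => h2 _ _ _ ha.1 hb.1, ?_⟩
    · have hnonempty : (B w \ {h}).Nonempty := by
        by_contra hn
        rw [Set.not_nonempty_iff_eq_empty, Set.diff_eq_empty] at hn
        exact hs w ((h1 w).1.subset_singleton_iff.1 hn)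
      refine conn_of _ hnonempty fun P ⟨z, hz, hzP⟩ hcl => ?_
      -- extend P by h when appropriate
      have := (h1 w).sub {v | (v ≠ h ∧ v ∈ P) ∨ (v = h ∧ ((h' ∈ B w ∧ h' ∈ P) ∨ (q ∈ B w ∧ q ∈ P)))}
        ⟨z, hz.1, Or.inl ⟨hz.2, hzP⟩⟩ (by
        have hstep : h' ∈ B w → q ∈ B w → (h' ∈ P ↔ q ∈ P) := fun a b =>
          ⟨hcl h' ⟨a, hne⟩ q ⟨b, hqne⟩ hq', hcl q ⟨b, hqne⟩ h' ⟨a, hne⟩ hq'.symm⟩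
        rintro u hu v hv huv (⟨hu1, huP⟩ | ⟨rfl, hu1⟩)
        · by_cases hvh : v = h
          · subst hvh
            right; refine ⟨rfl, ?_⟩
            rcases hN u huv.symm with rfl | rfl
            · exact Or.inl ⟨hu, huP⟩
            · exact Or.inr ⟨hu, huP⟩
          · left; exact ⟨hvh, hcl u ⟨hu, hu1⟩ v ⟨hv, hvh⟩ (hkeep _ _ huv hu1 hvh) huP⟩
        · left
          refine ⟨huv.ne.symm, ?_⟩
          rcases hN v huv with rfl | rfl
          · rcases hu1 with h5 | h5
            · exact h5.2
            · exact (hstep hv h5.1).2 h5.2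
          · rcases hu1 with h5 | h5
            · exact (hstep h5.1 hv).1 h5.2
            · exact h5.2)
      rintro v ⟨hv, hvh⟩
      rcases this hv with h5 | h5
      · exact h5.2
      · exact absurd h5.1 hvh
    · have main : ∀ c d, H.Adj c d → h ∈ B c → (∃ t ∈ B d, G.Adj h t) →
          Tch (supp G h h' q) (B c \ {h}) (B d \ {h}) := by
        rintro c d hcd hc ⟨t, ht, hht⟩
        rcases hN t hht with rfl | rfl
        · rcases hother c hc with h5 | h5
          · exact absurd (h2 _ _ _ h5 ht) hcd.ne
          · exact ⟨q, ⟨h5, hqne⟩, t, ⟨ht, hne⟩, hq'.symm⟩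
        · rcases hother c hc with h5 | h5
          · exact ⟨h', ⟨h5, hne⟩, t, ⟨ht, hqne⟩, hq'⟩
          · exact absurd (h2 _ _ _ h5 ht) hcd.ne
      intro c d hcd
      obtain ⟨s, hs', t, ht, hst⟩ := h3 c d hcd
      by_cases hsh : s = h
      · subst hsh; exact main c d hcd hs' ⟨t, ht, hst⟩
      by_cases hth : t = h
      · subst hth; exact (main d c hcd.symm ht ⟨s, hs', hst.symm⟩).symm
      exact ⟨s, ⟨hs', hsh⟩, t, ⟨ht, hth⟩, hkeep _ _ hst hsh hth⟩

end Ops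

open SimpleGraph

/-! ### Part 3: reducing an outerplanar piece to a path of length two -/

section Red
variable {W V : Type*} {H : SimpleGraph W}

/-- Index form of `xy`-outerplanarity. -/
structure OL (L : SimpleGraph V) (A : Set V) (x y : V) (n : ℕ) (u : ℕ → V) : Prop where
  inj : ∀ i j, i ≤ n → j ≤ n → u i = u j → i = j
  u0 : u 0 = x
  un : u n = y
  mem : ∀ v, v ∈ A ↔ ∃ i, i ≤ n ∧ u i = v
  chain : ∀ i, i < n → L.Adj (u i) (u (i+1))
  nc : ∀ i k j m, i < k → k < j → j < m → m ≤ n → ¬ (L.Adj (u i) (u j) ∧ L.Adj (u k) (u m))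

/-- The path `a b c`. -/
def P3 (a b c : V) : SimpleGraph V := SimpleGraph.fromEdgeSet {s(a, b), s(b, c)}

theorem P3_adj {a b c s t : V} : (P3 a b c).Adj s t ↔
    s ≠ t ∧ ((s = a ∧ t = b) ∨ (s = b ∧ t = a) ∨ (s = b ∧ t = c) ∨ (s = c ∧ t = b)) := by
  simp [P3]; tauto

theorem red_base {E L : SimpleGraph V} {A : Set V} {x y : V} {u : ℕ → V}
    (hL : OL L A x y 2 u) (hLA : ∀ s t, L.Adj s t → s ∈ A)
    (hno : ¬ L.Adj (u 0) (u 2)) (hm : IsMinor H (E ⊔ L)) : IsMinor H (E ⊔ P3 x (u 1) y) := by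
  refine hm.mono (sup_le_sup le_rfl ?_)
  intro s t hst
  obtain ⟨i, hi, rfl⟩ := (hL.mem s).1 (hLA _ _ hst)
  obtain ⟨j, hj, rfl⟩ := (hL.mem t).1 (hLA _ _ hst.symm)
  rw [P3_adj]
  refine ⟨hst.ne, ?_⟩
  rw [← hL.u0, ← hL.un]
  have h1 := hst.ne
  have hno' : ¬ L.Adj (u 2) (u 0) := fun h => hno h.symm
  interval_cases i <;> interval_cases j <;> simp_all

theorem red [Finite V] (hH : Nice H) (x y : V) (v1 : V) : ∀ (n : ℕ) (N : ℕ) (E L : SimpleGraph V) (A : Set V)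
    (u : ℕ → V), OL L A x y n u → 2 ≤ n → (∀ s t, L.Adj s t → s ∈ A) → L.edgeSet.ncard ≤ N → u 1 = v1 →
    (∀ i, 0 < i → i < n → ∀ t, ¬ E.Adj (u i) t) → IsMinor H (E ⊔ L) →
    IsMinor H (E ⊔ P3 x v1 y) := by
  intro n
  induction n with
  | zero => intro N E L A u _ h2; omega
  | succ n ihn =>
  intro N
  induction N with
  | zero =>
    intro E L A u hL hn _ hN _ _ _
    exfalso
    have h0 : L.edgeSet = ∅ := by
      rw [← Set.ncard_eq_zero (Set.toFinite _)]; omega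
    have := hL.chain 0 (by omega)
    rw [← SimpleGraph.mem_edgeSet, h0] at this
    exact this
  | succ N ihN =>
  intro E L A u hL hn hLA hN hv1 hE hm
  have hex : ∃ d a, 2 ≤ d ∧ a + d ≤ n + 1 ∧ (L.Adj (u a) (u (a + d)) ∨ (a = 0 ∧ d = n + 1)) :=
    ⟨n + 1, 0, hn, by omega, Or.inr ⟨rfl, rfl⟩⟩
  classical
  obtain ⟨a, hd2, had, hchord⟩ := Nat.find_spec hex
  have hmin := fun d' (h : d' < Nat.find hex) => Nat.find_min hex h
  generalize Nat.find hex = d at hd2 had hchord hmin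
  -- neighbours of interior indices
  have hdeg : ∀ t, a < t → t < a + d → ∀ v, (E ⊔ L).Adj (u t) v → v = u (t - 1) ∨ v = u (t + 1) := by
    intro t hat htb v hv
    rcases hv with hv | hv
    · exact absurd hv (hE t (by omega) (by omega) v)
    obtain ⟨j, hj, rfl⟩ := (hL.mem v).1 (hLA _ _ hv.symm)
    by_contra hcon
    push Not at hcon
    have hj1 : j ≠ t - 1 := by rintro rfl; exact hcon.1 rfl
    have hj2 : j ≠ t + 1 := by rintro rfl; exact hcon.2 rfl
    have hj3 : j ≠ t := by rintro rfl; exact hv.ne rfl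
    by_cases h1 : j < a
    · rcases hchord with h | h
      · exact hL.nc j a t (a + d) h1 hat htb had ⟨hv.symm, h⟩
      · omega
    by_cases h2 : a + d < j
    · rcases hchord with h | h
      · exact hL.nc a t (a + d) j hat htb h2 hj ⟨h, hv⟩
      · omega
    by_cases h3 : j < t
    · refine hmin (t - j) (by omega) ⟨j, by omega, by omega, Or.inl ?_⟩
      rw [show j + (t - j) = t by omega]; exact hv.symm
    · refine hmin (j - t) (by omega) ⟨t, by omega, by omega, Or.inl ?_⟩
      rw [show t + (j - t) = j by omega]; exact hv
  have hch : ∀ i, i < n + 1 → (E ⊔ L).Adj (u i) (u (i+1)) := fun i hi => Or.inr (hL.chain i hi)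
  by_cases hd : d = 2
  · subst hd
    by_cases hc : L.Adj (u a) (u (a + 2))
    · -- delete the chord
      have hop := op1 hH (hch a (by omega)).symm (hch (a+1) (by omega))
        (fun v hv => by simpa using hdeg (a+1) (by omega) (by omega) v hv) hm
      refine ihN E (L.deleteEdges {s(u a, u (a+2))}) A u ?_ hn ?_ ?_ hv1 hE ?_
      · refine ⟨hL.inj, hL.u0, hL.un, hL.mem, ?_, ?_⟩
        · intro i hi
          rw [SimpleGraph.deleteEdges_adj]
          refine ⟨hL.chain i hi, ?_⟩
          simp only [Set.mem_singleton_iff, Sym2.eq_iff]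
          rintro (⟨h1, h2⟩ | ⟨h1, h2⟩)
          · have := hL.inj _ _ (by omega) (by omega) h1
            have := hL.inj _ _ (by omega) (by omega) h2
            omega
          · have := hL.inj _ _ (by omega) (by omega) h1
            have := hL.inj _ _ (by omega) (by omega) h2
            omega
        · intro i k j m h1 h2 h3 h4 h5
          exact hL.nc i k j m h1 h2 h3 h4 ⟨SimpleGraph.deleteEdges_le _ h5.1, SimpleGraph.deleteEdges_le _ h5.2⟩
      · intro s t hst
        exact hLA s t (SimpleGraph.deleteEdges_le _ hst)
      · rw [SimpleGraph.edgeSet_deleteEdges]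
        have := Set.ncard_diff_singleton_lt_of_mem (s := L.edgeSet) (a := s(u a, u (a+2))) hc (Set.toFinite _)
        omega
      · refine hop.mono ?_
        intro s t hst
        rw [SimpleGraph.deleteEdges_adj] at hst
        rcases hst.1 with h | h
        · exact Or.inl h
        · exact Or.inr (by rw [SimpleGraph.deleteEdges_adj]; exact ⟨h, hst.2⟩)
    · have h0 : a = 0 ∧ 2 = n + 1 := hchord.resolve_left hc
      obtain ⟨rfl, h0⟩ := h0
      obtain rfl : n = 1 := by omega
      rw [← hv1]
      exact red_base hL hLA (by simpa using hc) hm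
  · -- suppress index a + 2
    have hne : ∀ i j, i ≤ n + 1 → j ≤ n + 1 → i ≠ j → u i ≠ u j := fun i j hi hj hij h =>
      hij (hL.inj i j hi hj h)
    have hop := op2 hH (h := u (a+2)) (h' := u (a+1)) (p := u a) (q := u (a+3)) (hch (a+1) (by omega)).symm
      (hch (a+2) (by omega)) (hch a (by omega)).symm (hne _ _ (by omega) (by omega) (by omega))
      (hne _ _ (by omega) (by omega) (by omega))
      (fun v hv => hdeg (a+2) (by omega) (by omega) v hv)
      (fun v hv => (hdeg (a+1) (by omega) (by omega) v hv).symm) hm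
    let f : ℕ → ℕ := fun i => if i < a + 2 then i else i + 1
    have hf1 : ∀ i, i < a + 2 → f i = i := fun i hi => by simp [f, hi]
    have hf2 : ∀ i, a + 2 ≤ i → f i = i + 1 := fun i hi => by simp [f, not_lt.2 hi]
    have hfle : ∀ i, i ≤ n → f i ≤ n + 1 := fun i hi => by simp only [f]; split_ifs <;> omega
    have hfne : ∀ i, f i ≠ a + 2 := fun i => by simp only [f]; split_ifs <;> omega
    have hfmono : ∀ i j, i < j → f i < f j := fun i j hij => by simp only [f]; split_ifs <;> omega
    have hfsur : ∀ i, i ≠ a + 2 → i ≤ n + 1 → ∃ j, j ≤ n ∧ f j = i := fun i hi hin => by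
      by_cases h : i < a + 2
      · exact ⟨i, by omega, hf1 i h⟩
      · exact ⟨i - 1, by omega, by rw [hf2 _ (by omega)]; omega⟩
    have hadj' : ∀ i j, i ≤ n → j ≤ n → (supp L (u (a+2)) (u (a+1)) (u (a+3))).Adj (u (f i)) (u (f j)) →
        L.Adj (u (f i)) (u (f j)) ∨ (i = a + 1 ∧ j = a + 2) ∨ (i = a + 2 ∧ j = a + 1) := by
      rintro i j hi hj ⟨-, h | ⟨h1, h2⟩ | ⟨h1, h2⟩⟩
      · exact Or.inl h.1
      · right; left
        have h1 := hL.inj _ _ (hfle i hi) (by omega) h1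
        have h2 := hL.inj _ _ (hfle j hj) (by omega) h2
        simp only [f] at h1 h2
        split_ifs at h1 h2 <;> omega
      · right; right
        have h1 := hL.inj _ _ (hfle i hi) (by omega) h1
        have h2 := hL.inj _ _ (hfle j hj) (by omega) h2
        simp only [f] at h1 h2
        split_ifs at h1 h2 <;> omega
    refine ihn _ E (supp L (u (a+2)) (u (a+1)) (u (a+3))) (A \ {u (a+2)}) (fun i => u (f i)) ?_ (by omega) ?_ le_rfl ?_ ?_ ?_
    · refine ⟨?_, ?_, ?_, ?_, ?_, ?_⟩
      · intro i j hi hj hij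
        have h1 := hL.inj _ _ (hfle i hi) (hfle j hj) hij
        simp only [f] at h1
        split_ifs at h1 <;> omega
      · change u (f 0) = x
        rw [hf1 0 (by omega), hL.u0]
      · change u (f n) = y
        rw [hf2 n (by omega), hL.un]
      · intro v
        constructor
        · rintro ⟨hv, hvne⟩
          obtain ⟨i, hi, rfl⟩ := (hL.mem v).1 hv
          obtain ⟨j, hj, rfl⟩ := hfsur i (by rintro rfl; exact hvne rfl) hi
          exact ⟨j, hj, rfl⟩
        · rintro ⟨i, hi, rfl⟩
          exact ⟨(hL.mem _).2 ⟨f i, hfle i hi, rfl⟩, hne _ _ (hfle i hi) (by omega) (hfne i)⟩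
      · intro i hi
        change (supp L (u (a+2)) (u (a+1)) (u (a+3))).Adj (u (f i)) (u (f (i+1)))
        refine ⟨hne _ _ (hfle _ (by omega)) (hfle _ (by omega)) (hfmono _ _ (by omega)).ne, ?_⟩
        by_cases h1 : i = a + 1
        · subst h1
          right; left
          rw [hf1 _ (by omega), hf2 _ (by omega)]
          exact ⟨rfl, rfl⟩
        · left
          refine ⟨?_, hne _ _ (hfle _ (by omega)) (by omega) (hfne _), hne _ _ (hfle _ (by omega)) (by omega) (hfne _)⟩
          have : f (i + 1) = f i + 1 := by simp only [f]; split_ifs <;> omega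
          rw [this]
          exact hL.chain _ (by have := hfle (i+1) (by omega); omega)
      · rintro i k j m h1 h2 h3 h4 ⟨h5, h6⟩
        rcases hadj' i j (by omega) (by omega) h5 with h5 | h5
        · rcases hadj' k m (by omega) (by omega) h6 with h6 | h6
          · exact hL.nc _ _ _ _ (hfmono _ _ h1) (hfmono _ _ h2) (hfmono _ _ h3) (hfle m h4) ⟨h5, h6⟩
          · omega
        · omega
    · intro s t hst
      obtain ⟨hst0, h | ⟨h1, h2⟩ | ⟨h1, h2⟩⟩ := hst
      · exact ⟨hLA _ _ h.1, h.2.1⟩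
      · subst h1
        exact ⟨(hL.mem _).2 ⟨_, by omega, rfl⟩, hne _ _ (by omega) (by omega) (by omega)⟩
      · subst h1
        exact ⟨(hL.mem _).2 ⟨_, by omega, rfl⟩, hne _ _ (by omega) (by omega) (by omega)⟩
    · change u (f 1) = v1
      rw [hf1 1 (by omega), hv1]
    · intro i hi0 hin
      have h1 : 0 < f i := by have := hfmono 0 i hi0; omega
      have h2 : f i < n + 1 := by have := hfmono i n hin; have := hfle n le_rfl; omega
      exact hE (f i) h1 h2
    · refine hop.mono ?_
      rintro s t ⟨hst, ⟨h1 | h1, h2, h3⟩ | h1 | h1⟩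
      · exact Or.inl h1
      · exact Or.inr ⟨hst, Or.inl ⟨h1, h2, h3⟩⟩
      · exact Or.inr ⟨hst, Or.inr (Or.inl h1)⟩
      · exact Or.inr ⟨hst, Or.inr (Or.inr h1)⟩

/-- Reduction, packaged. -/
theorem OL.reduce [Finite V] {L : SimpleGraph V} {A : Set V} {x y : V} {n : ℕ} {u : ℕ → V}
    (hL : OL L A x y n u) (hLA : ∀ s t, L.Adj s t → s ∈ A) (hxy : x ≠ y) (hthird : ∃ v ∈ A, v ≠ x ∧ v ≠ y) :
    ∃ h ∈ A, h ≠ x ∧ h ≠ y ∧ ∀ E : SimpleGraph V, (∀ v ∈ A, v ≠ x → v ≠ y → ∀ t, ¬ E.Adj v t) →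
      ∀ {W : Type} (H : SimpleGraph W), Nice H → IsMinor H (E ⊔ L) → IsMinor H (E ⊔ P3 x h y) := by
  have hn : 2 ≤ n := by
    obtain ⟨v, hv, hvx, hvy⟩ := hthird
    obtain ⟨i, hi, rfl⟩ := (hL.mem v).1 hv
    have h0 : i ≠ 0 := by rintro rfl; exact hvx hL.u0
    have h1 : i ≠ n := by rintro rfl; exact hvy hL.un
    omega
  have hne : ∀ i, 0 < i → i < n → u i ≠ x ∧ u i ≠ y := by
    intro i h0 h1
    constructor
    · intro h; rw [← hL.u0] at h; have := hL.inj _ _ (by omega) (by omega) h; omega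
    · intro h; rw [← hL.un] at h; have := hL.inj _ _ (by omega) (by omega) h; omega
  refine ⟨u 1, (hL.mem _).2 ⟨1, by omega, rfl⟩, (hne 1 (by omega) (by omega)).1,
    (hne 1 (by omega) (by omega)).2, ?_⟩
  intro E hE W H hH hm
  refine red hH x y (u 1) n _ E L A u hL hn hLA le_rfl rfl ?_ hm
  intro i h0 h1
  exact hE (u i) ((hL.mem _).2 ⟨i, by omega, rfl⟩) (hne i h0 h1).1 (hne i h0 h1).2

theorem OL.of_xy {L : SimpleGraph V} {A : Set V} {x y : V} (h : XYOuterplanar L A x y) :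
    ∃ n u, OL L A x y n u := by
  obtain ⟨l, hmem, hhead, hlast, hnd, hch, hnc⟩ := h
  have hlen : 0 < l.length := by
    cases l with
    | nil => simp at hhead
    | cons a t => simp
  have hget : ∀ i, i < l.length → l[i]? = some (l.getD i x) := by
    intro i hi; simp [hi]
  have hgd : ∀ i (hi : i < l.length), l.getD i x = l[i] := by
    intro i hi; simp [hi]
  refine ⟨l.length - 1, fun i => l.getD i x, ?_, ?_, ?_, ?_, ?_, ?_⟩
  · intro i j hi hj hij
    rw [hgd i (by omega), hgd j (by omega)] at hij
    exact (List.Nodup.getElem_inj_iff hnd).1 hij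
  · have := hget 0 hlen
    rw [← List.head?_eq_getElem?, hhead] at this
    simpa using this.symm
  · have := hget (l.length - 1) (by omega)
    rw [← List.getLast?_eq_getElem?, hlast] at this
    simpa using this.symm
  · intro v
    rw [← hmem, List.mem_iff_getElem]
    constructor
    · rintro ⟨i, hi, rfl⟩; exact ⟨i, by omega, hgd i hi⟩
    · rintro ⟨i, hi, rfl⟩; exact ⟨i, by omega, (hgd i (by omega)).symm⟩
  · intro i hi
    have := (List.isChain_iff_getElem.1 hch) i (by omega)
    simp only [hgd i (by omega), hgd (i+1) (by omega)]
    exact this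
  · intro i k j m h1 h2 h3 h4
    simp only [hgd i (by omega), hgd k (by omega), hgd j (by omega), hgd m (by omega)]
    exact hnc i k j m h1 h2 h3 (by omega)

theorem OL.to_xy {L : SimpleGraph V} {A : Set V} {x y : V} {n u} (h : OL L A x y n u) :
    XYOuterplanar L A x y := by
  refine ⟨(List.range (n+1)).map u, ?_, ?_, ?_, ?_, ?_, ?_⟩
  · intro v
    rw [h.mem]
    simp [Nat.lt_succ_iff]
  · simp [List.range_succ_eq_map, h.u0]
  · simp [List.range_succ, h.un]
  · refine List.Nodup.map_on ?_ List.nodup_range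
    intro i hi j hj hij
    simp at hi hj
    exact h.inj i j (by omega) (by omega) hij
  · change List.IsChain _ _
    rw [List.isChain_iff_getElem]
    intro i hi
    simp at hi ⊢
    exact h.chain i hi
  · intro i k j m h1 h2 h3 hm
    simp at hm ⊢
    intro h5 h6
    exact h.nc i k j m h1 h2 h3 (by omega) ⟨h5, h6⟩

end Red

open SimpleGraph

/-! ### Part 4: the sufficiency direction -/

theorem nice_K2 (m : ℕ) : Nice (completeBipartiteGraph (Fin 2) (Fin (m + 3))) := by
  have h : ∀ s t, (completeBipartiteGraph (Fin 2) (Fin (m + 3))).Adj s t ↔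
    (s.isLeft ∧ t.isRight ∨ s.isRight ∧ t.isLeft) := fun s t => Iff.rfl
  have key : ∀ (w : Fin 2) (a b : Fin 2 ⊕ Fin (m + 3)),
      ¬ ∀ c, (completeBipartiteGraph (Fin 2) (Fin (m + 3))).Adj (Sum.inl w) c → c = a ∨ c = b := by
    intro w a b hc
    have h0 := hc (Sum.inr ⟨0, by omega⟩) (by simp [h])
    have h1 := hc (Sum.inr ⟨1, by omega⟩) (by simp [h])
    have h2 := hc (Sum.inr ⟨2, by omega⟩) (by simp [h])
    rcases h0 with rfl | rfl <;> rcases h1 with h1 | h1 <;> rcases h2 with h2 | h2 <;> simp at h1 h2 <;>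
      (rw [← h1] at h2; simp at h2)
  intro w a b hw
  rcases w with w | w
  · exact absurd hw (key w a b)
  · have h0 := hw (Sum.inl 0) (by simp [h])
    have h1 := hw (Sum.inl 1) (by simp [h])
    rcases h0 with rfl | rfl <;> rcases h1 with h1 | h1
    · simp at h1
    · subst h1
      exact ⟨by simp, by simp, fun d => key 0 _ d⟩
    · subst h1
      exact ⟨by simp, by simp, fun d => key 1 _ d⟩
    · simp at h1

theorem nice_K24 : Nice K24 := nice_K2 1

theorem nice_K23 : Nice (completeBipartiteGraph (Fin 2) (Fin 3)) := nice_K2 0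

theorem nice_K4 : Nice (completeGraph (Fin 4)) := by
  unfold Nice
  have h : ∀ s t, (completeGraph (Fin 4)).Adj s t ↔ s ≠ t := fun s t => Iff.rfl
  simp only [h]
  decide

section Suff
variable {V : Type*}

theorem K24_of_K23 {G : SimpleGraph V} (h : IsMinor K24 G) :
    IsMinor (completeBipartiteGraph (Fin 2) (Fin 3)) G := by
  obtain ⟨B, h1, h2, h3⟩ := h
  let f : Fin 2 ⊕ Fin 3 → Fin 2 ⊕ Fin 4 := Sum.map id Fin.castSucc
  have hf : Function.Injective f := Sum.map_injective.2 ⟨Function.injective_id, Fin.castSucc_injective 3⟩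
  refine ⟨fun w => B (f w), fun w => h1 _, fun a b hab => h2 _ _ (hf.ne hab), fun a b hab => h3 _ _ ?_⟩
  rcases a with a | a <;> rcases b with b | b <;> simp_all [K24, f]

theorem suff_ii [Fintype V] {G : SimpleGraph V} {x y : V} (hxy : x ≠ y) (H₁ H₂ H₃ : G.Subgraph)
    (o1 : XYOuterplanar H₁.spanningCoe H₁.verts x y)
    (o2 : XYOuterplanar H₂.spanningCoe H₂.verts x y)
    (o3 : XYOuterplanar H₃.spanningCoe H₃.verts x y)
    (c1 : 3 ≤ H₁.verts.ncard) (c2 : 3 ≤ H₂.verts.ncard) (c3 : 3 ≤ H₃.verts.ncard)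
    (i12 : H₁.verts ∩ H₂.verts = {x, y}) (i13 : H₁.verts ∩ H₃.verts = {x, y})
    (i23 : H₂.verts ∩ H₃.verts = {x, y})
    (hU : H₁ ⊔ H₂ ⊔ H₃ = ⊤ ∨ ∃ h : G.Adj x y, H₁ ⊔ H₂ ⊔ H₃ ⊔ G.subgraphOfAdj h = ⊤) :
    MinorFree K24 G := by
  intro hm
  have third : ∀ A : Set V, 3 ≤ A.ncard → ∃ v ∈ A, v ≠ x ∧ v ≠ y := by
    intro A hA
    by_contra hn
    push Not at hn
    have : A ⊆ {x, y} := fun v hv => by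
      by_cases h : v = x
      · exact Or.inl h
      · exact Or.inr (hn v hv h)
    have := Set.ncard_le_ncard this (Set.toFinite _)
    rw [Set.ncard_pair hxy] at this
    omega
  obtain ⟨n1, u1, l1⟩ := OL.of_xy o1
  obtain ⟨n2, u2, l2⟩ := OL.of_xy o2
  obtain ⟨n3, u3, l3⟩ := OL.of_xy o3
  have sup : ∀ (K : G.Subgraph) s t, K.spanningCoe.Adj s t → s ∈ K.verts := fun K s t h => K.edge_vert h
  obtain ⟨h1, m1, a1, b1, r1⟩ := l1.reduce (sup H₁) hxy (third _ c1)
  obtain ⟨h2, m2, a2, b2, r2⟩ := l2.reduce (sup H₂) hxy (third _ c2)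
  obtain ⟨h3, m3, a3, b3, r3⟩ := l3.reduce (sup H₃) hxy (third _ c3)
  let E : SimpleGraph V := SimpleGraph.fromEdgeSet {s(x, y)}
  have hEadj : ∀ s t, E.Adj s t → s = x ∨ s = y := by
    intro s t h
    simp [E] at h
    tauto
  have d12 : ∀ v, v ∈ H₁.verts → v ∈ H₂.verts → v = x ∨ v = y := fun v h h' => by
    have : v ∈ H₁.verts ∩ H₂.verts := ⟨h, h'⟩
    rw [i12] at this; exact this
  have d13 : ∀ v, v ∈ H₁.verts → v ∈ H₃.verts → v = x ∨ v = y := fun v h h' => by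
    have : v ∈ H₁.verts ∩ H₃.verts := ⟨h, h'⟩
    rw [i13] at this; exact this
  have d23 : ∀ v, v ∈ H₂.verts → v ∈ H₃.verts → v = x ∨ v = y := fun v h h' => by
    have : v ∈ H₂.verts ∩ H₃.verts := ⟨h, h'⟩
    rw [i23] at this; exact this
  have hle : G ≤ (E ⊔ H₂.spanningCoe ⊔ H₃.spanningCoe) ⊔ H₁.spanningCoe := by
    intro s t hst
    have : (⊤ : G.Subgraph).Adj s t := hst
    simp only [SimpleGraph.sup_adj, SimpleGraph.Subgraph.spanningCoe_adj]
    rcases hU with h | ⟨h0, h⟩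
    · rw [← h] at this
      simp only [SimpleGraph.Subgraph.sup_adj] at this
      tauto
    · rw [← h] at this
      simp only [SimpleGraph.Subgraph.sup_adj] at this
      rcases this with h5 | h5
      · tauto
      · simp only [SimpleGraph.subgraphOfAdj_adj] at h5
        left; left; left
        simp only [E, SimpleGraph.fromEdgeSet_adj, Set.mem_singleton_iff]
        exact ⟨h5.symm, hst.ne⟩
  have s1 := r1 (E ⊔ H₂.spanningCoe ⊔ H₃.spanningCoe) (by
    rintro v hv hvx hvy t ((h | h) | h)
    · rcases hEadj _ _ h with h | h <;> contradiction
    · rcases d12 v hv (H₂.edge_vert h) with h | h <;> contradiction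
    · rcases d13 v hv (H₃.edge_vert h) with h | h <;> contradiction) K24 nice_K24 (hm.mono hle)
  have p1 : ∀ s t, (P3 x h1 y).Adj s t → s ∈ H₁.verts := by
    intro s t h
    rw [P3_adj] at h
    have hx := (l1.mem x).2 ⟨0, by omega, l1.u0⟩
    have hy := (l1.mem y).2 ⟨n1, le_rfl, l1.un⟩
    rcases h.2 with ⟨h, -⟩ | ⟨h, -⟩ | ⟨h, -⟩ | ⟨h, -⟩ <;> rw [h] <;> assumption
  have p2 : ∀ s t, (P3 x h2 y).Adj s t → s ∈ H₂.verts := by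
    intro s t h
    rw [P3_adj] at h
    have hx := (l2.mem x).2 ⟨0, by omega, l2.u0⟩
    have hy := (l2.mem y).2 ⟨n2, le_rfl, l2.un⟩
    rcases h.2 with ⟨h, -⟩ | ⟨h, -⟩ | ⟨h, -⟩ | ⟨h, -⟩ <;> rw [h] <;> assumption
  have s2 := r2 (E ⊔ P3 x h1 y ⊔ H₃.spanningCoe) (by
    rintro v hv hvx hvy t ((h | h) | h)
    · rcases hEadj _ _ h with h | h <;> contradiction
    · rcases d12 v (p1 _ _ h) hv with h | h <;> contradiction
    · rcases d23 v hv (H₃.edge_vert h) with h | h <;> contradiction) K24 nice_K24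
    (s1.mono (by intro s t h; simp only [SimpleGraph.sup_adj] at h ⊢; tauto))
  have s3 := r3 (E ⊔ P3 x h1 y ⊔ P3 x h2 y) (by
    rintro v hv hvx hvy t ((h | h) | h)
    · rcases hEadj _ _ h with h | h <;> contradiction
    · rcases d13 v (p1 _ _ h) hv with h | h <;> contradiction
    · rcases d23 v (p2 _ _ h) hv with h | h <;> contradiction) K24 nice_K24
    (s2.mono (by intro s t h; simp only [SimpleGraph.sup_adj] at h ⊢; tauto))
  classical
  refine not_isMinor_of_card (G := E ⊔ P3 x h1 y ⊔ P3 x h2 y ⊔ P3 x h3 y) nice_K24.noniso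
    {x, y, h1, h2, h3} ?_ ?_ s3
  · intro s t h
    simp only [SimpleGraph.sup_adj, P3_adj] at h
    simp only [Finset.mem_insert, Finset.mem_singleton]
    rcases h with ((h | h) | h) | h
    · rcases hEadj s t h with h | h <;> simp [h]
    · rcases h.2 with ⟨h, -⟩ | ⟨h, -⟩ | ⟨h, -⟩ | ⟨h, -⟩ <;> simp [h]
    · rcases h.2 with ⟨h, -⟩ | ⟨h, -⟩ | ⟨h, -⟩ | ⟨h, -⟩ <;> simp [h]
    · rcases h.2 with ⟨h, -⟩ | ⟨h, -⟩ | ⟨h, -⟩ | ⟨h, -⟩ <;> simp [h]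
  · have : ({x, y, h1, h2, h3} : Finset V).card ≤ 5 := Finset.card_le_five
    simp; omega

theorem sub_adj_ll {V₀ : Type*} {G₀ : SimpleGraph V₀} {F : Set (Sym2 V₀)} {a b : V₀} :
    (SubdivideEdges G₀ F).Adj (Sum.inl a) (Sum.inl b) ↔ G₀.Adj a b ∧ s(a, b) ∉ F := by
  simp only [SubdivideEdges, SimpleGraph.fromRel_adj, ne_eq, Sum.inl.injEq]
  constructor
  · rintro ⟨h0, h | h⟩
    · exact h
    · rw [Sym2.eq_swap]; exact ⟨h.1.symm, h.2⟩
  · intro h; exact ⟨h.1.ne, Or.inl h⟩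

theorem sub_adj_lr {V₀ : Type*} {G₀ : SimpleGraph V₀} {F : Set (Sym2 V₀)} {a : V₀} {e : F} :
    (SubdivideEdges G₀ F).Adj (Sum.inl a) (Sum.inr e) ↔ a ∈ (e : Sym2 V₀) := by
  simp [SubdivideEdges]

theorem sub_adj_rr {V₀ : Type*} {G₀ : SimpleGraph V₀} {F : Set (Sym2 V₀)} {e f : F} :
    ¬ (SubdivideEdges G₀ F).Adj (Sum.inr e) (Sum.inr f) := by
  simp [SubdivideEdges]

theorem suff_iii [Fintype V] {G : SimpleGraph V} (V₀ : Type) (G₀ : SimpleGraph V₀) (k : ℕ)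
    (xx yy : Fin k → V₀) (φ : V₀ ↪ V) (H : Fin k → G.Subgraph)
    (hadj : ∀ i, G₀.Adj (xx i) (yy i))
    (hinj : Function.Injective (fun i => s(xx i, yy i)))
    (hsub : Subdividable G₀ {e | ∃ i, e = s(xx i, yy i)})
    (ho : ∀ i, XYOuterplanar (H i).spanningCoe (H i).verts (φ (xx i)) (φ (yy i)))
    (hran : ∀ i, (H i).verts ∩ Set.range φ = {φ (xx i), φ (yy i)})
    (hij : ∀ i j, i ≠ j → (H i).verts ∩ (H j).verts ⊆ Set.range φ)
    (hG : ∀ u v : V, G.Adj u v ↔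
          ((∃ a b : V₀, u = φ a ∧ v = φ b ∧ G₀.Adj a b ∧
              ∀ i, s(a, b) ≠ s(xx i, yy i)) ∨
           (∃ i, (H i).Adj u v))) : MinorFree K24 G := by
  intro hm
  apply hsub.2
  classical
  let nt : Fin k → Prop := fun i => ∃ v ∈ (H i).verts, v ≠ φ (xx i) ∧ v ≠ φ (yy i)
  have hne : ∀ i, φ (xx i) ≠ φ (yy i) := fun i h => (hadj i).ne (φ.injective h)
  have hxv : ∀ i, φ (xx i) ∈ (H i).verts := fun i => by
    have : φ (xx i) ∈ (H i).verts ∩ Set.range φ := by rw [hran]; simp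
    exact this.1
  have hyv : ∀ i, φ (yy i) ∈ (H i).verts := fun i => by
    have : φ (yy i) ∈ (H i).verts ∩ Set.range φ := by rw [hran]; simp
    exact this.1
  have hends : ∀ i v, v ∈ (H i).verts → v ∈ Set.range φ → v = φ (xx i) ∨ v = φ (yy i) := fun i v h h' => by
    have : v ∈ (H i).verts ∩ Set.range φ := ⟨h, h'⟩
    rw [hran] at this; exact this
  have hred : ∀ i, ∃ h, nt i → (h ∈ (H i).verts ∧ h ≠ φ (xx i) ∧ h ≠ φ (yy i) ∧
      ∀ E : SimpleGraph V, (∀ v ∈ (H i).verts, v ≠ φ (xx i) → v ≠ φ (yy i) → ∀ t, ¬ E.Adj v t) →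
      IsMinor K24 (E ⊔ (H i).spanningCoe) → IsMinor K24 (E ⊔ P3 (φ (xx i)) h (φ (yy i)))) := by
    intro i
    by_cases hi : nt i
    · obtain ⟨n, u, l⟩ := OL.of_xy (ho i)
      obtain ⟨h, a, b, c, d⟩ := l.reduce (fun s t h => (H i).edge_vert h) (hne i) hi
      exact ⟨h, fun _ => ⟨a, b, c, fun E hE => d E hE K24 nice_K24⟩⟩
    · exact ⟨φ (xx i), fun h => absurd h hi⟩
  choose h hh using hred
  have hhr : ∀ i, nt i → h i ∉ Set.range φ := fun i hi hr => by
    rcases hends i _ (hh i hi).1 hr with h5 | h5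
    · exact (hh i hi).2.1 h5
    · exact (hh i hi).2.2.1 h5
  let Q : Fin k → SimpleGraph V := fun i =>
    if nt i then P3 (φ (xx i)) (h i) (φ (yy i)) else (H i).spanningCoe
  have hQv : ∀ i s t, (Q i).Adj s t → s ∈ (H i).verts := by
    intro i s t hst
    by_cases hi : nt i
    · simp only [Q, hi, if_true, P3_adj] at hst
      have h1 := hxv i; have h2 := hyv i; have h3 := (hh i hi).1
      rcases hst.2 with ⟨h, -⟩ | ⟨h, -⟩ | ⟨h, -⟩ | ⟨h, -⟩ <;> rw [h] <;> assumption
    · simp only [Q, hi, if_false] at hst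
      exact (H i).edge_vert hst
  let E₀ : SimpleGraph V := SimpleGraph.fromRel fun u v =>
    ∃ a b : V₀, u = φ a ∧ v = φ b ∧ G₀.Adj a b ∧ ∀ i, s(a, b) ≠ s(xx i, yy i)
  have hE₀ : ∀ s t, E₀.Adj s t → ∃ a b : V₀, s = φ a ∧ t = φ b ∧ G₀.Adj a b ∧ ∀ i, s(a, b) ≠ s(xx i, yy i) := by
    rintro s t ⟨-, h | ⟨a, b, h1, h2, h3, h4⟩⟩
    · exact h
    · exact ⟨b, a, h2, h1, h3.symm, fun i => by rw [Sym2.eq_swap]; exact h4 i⟩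
  let Γ : Finset (Fin k) → SimpleGraph V := fun J =>
    E₀ ⊔ ⨆ i, (if i ∈ J then Q i else (H i).spanningCoe)
  have hΓ : ∀ J, IsMinor K24 (Γ J) := by
    intro J
    induction J using Finset.induction_on with
    | empty =>
      refine hm.mono ?_
      intro s t hst
      rcases (hG s t).1 hst with h5 | ⟨i, h5⟩
      · exact Or.inl ⟨hst.ne, Or.inl h5⟩
      · refine Or.inr ?_
        rw [SimpleGraph.iSup_adj]
        exact ⟨i, by simpa using h5⟩
    | insert i J hiJ ih =>
      by_cases hi : nt i
      · let E : SimpleGraph V := E₀ ⊔ ⨆ j, (if j = i then ⊥ else if j ∈ J then Q j else (H j).spanningCoe)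
        have := (hh i hi).2.2.2 E (by
          rintro v hv hvx hvy t (h5 | h5)
          · obtain ⟨a, b, rfl, rfl, -⟩ := hE₀ _ _ h5
            rcases hends i _ hv ⟨a, rfl⟩ with h | h <;> contradiction
          · rw [SimpleGraph.iSup_adj] at h5
            obtain ⟨j, h5⟩ := h5
            by_cases hji : j = i
            · simp [hji] at h5
            · simp only [hji, if_false] at h5
              have hvj : v ∈ (H j).verts := by
                split_ifs at h5
                · exact hQv j _ _ h5
                · exact (H j).edge_vert h5
              rcases hends i v hv (hij j i hji ⟨hvj, hv⟩) with h | h <;> contradiction) (by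
          refine ih.mono ?_
          rintro s t (h5 | h5)
          · exact Or.inl (Or.inl h5)
          · rw [SimpleGraph.iSup_adj] at h5
            obtain ⟨j, h5⟩ := h5
            by_cases hji : j = i
            · subst hji
              simp only [hiJ, if_false] at h5
              exact Or.inr h5
            · left; right
              rw [SimpleGraph.iSup_adj]
              exact ⟨j, by simpa only [hji, if_false] using h5⟩)
        refine this.mono ?_
        rintro s t ((h5 | h5) | h5)
        · exact Or.inl h5
        · right
          rw [SimpleGraph.iSup_adj] at h5 ⊢
          obtain ⟨j, h5⟩ := h5
          refine ⟨j, ?_⟩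
          by_cases hji : j = i
          · simp [hji] at h5
          · simpa only [hji, if_false, Finset.mem_insert, false_or] using h5
        · right
          rw [SimpleGraph.iSup_adj]
          refine ⟨i, ?_⟩
          simpa only [Finset.mem_insert, true_or, if_true, Q, hi] using h5
      · refine ih.mono ?_
        rintro s t (h5 | h5)
        · exact Or.inl h5
        · right
          rw [SimpleGraph.iSup_adj] at h5 ⊢
          obtain ⟨j, h5⟩ := h5
          refine ⟨j, ?_⟩
          by_cases hji : j = i
          · subst hji
            simp only [hiJ, if_false] at h5
            simpa only [Finset.mem_insert, true_or, if_true, Q, hi, if_false] using h5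
          · simpa only [hji, Finset.mem_insert, false_or] using h5
  have hfin := hΓ Finset.univ
  -- map to the subdivision
  let F : Set (Sym2 V₀) := {e | ∃ i, e = s(xx i, yy i)}
  let ed : Fin k → F := fun i => ⟨s(xx i, yy i), i, rfl⟩
  have hed : ∀ i j, ed i = ed j → i = j := fun i j hij => hinj (congrArg Subtype.val hij)
  let C : V → Set (V₀ ⊕ F) := fun v => {z | (∃ a, z = Sum.inl a ∧ φ a = v) ∨
    ∃ i, z = Sum.inr (ed i) ∧ ((nt i ∧ v = h i) ∨ (¬ nt i ∧ v = φ (xx i)))}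
  have hCφ : ∀ a, Conn (SubdivideEdges G₀ F) (C (φ a)) := by
    intro a
    refine conn_of_base _ (Sum.inl a) (Or.inl ⟨a, rfl, rfl⟩) fun P hP ⟨z, hz⟩ hcl => ?_
    rcases hP hz with ⟨b, rfl, hb⟩ | ⟨i, rfl, ⟨hi, hv⟩ | ⟨hi, hv⟩⟩
    · cases φ.injective hb; exact hz
    · exact absurd ⟨a, hv⟩ (hhr i hi)
    · refine hcl _ hz (Sum.inl a) (Or.inl ⟨a, rfl, rfl⟩) ?_
      rw [SimpleGraph.adj_comm, sub_adj_lr]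
      cases φ.injective hv
      simp [ed]
  have hhinj : ∀ i j, nt i → nt j → h i = h j → i = j := by
    intro i j hi hj hE
    by_contra hne
    exact hhr i hi (hij i j hne ⟨(hh i hi).1, hE ▸ (hh j hj).1⟩)
  have hCh : ∀ i, nt i → Conn (SubdivideEdges G₀ F) (C (h i)) := by
    intro i hi
    have : C (h i) = {Sum.inr (ed i)} := by
      ext z
      constructor
      · rintro (⟨a, rfl, ha⟩ | ⟨j, rfl, ⟨hj, hv⟩ | ⟨hj, hv⟩⟩)
        · exact absurd ⟨a, ha⟩ (hhr i hi)
        · rw [hhinj i j hi hj hv]; rfl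
        · exact absurd ⟨_, hv.symm⟩ (hhr i hi)
      · rintro rfl
        exact Or.inr ⟨i, rfl, Or.inl ⟨hi, rfl⟩⟩
    rw [this]; exact conn_singleton _
  have hφmem : ∀ a, Sum.inl a ∈ C (φ a) := fun a => Or.inl ⟨a, rfl, rfl⟩
  have hhmem : ∀ i, nt i → Sum.inr (ed i) ∈ C (h i) := fun i hi => Or.inr ⟨i, rfl, Or.inl ⟨hi, rfl⟩⟩
  have hxadj : ∀ i, (SubdivideEdges G₀ F).Adj (Sum.inl (xx i)) (Sum.inr (ed i)) := fun i => by
    rw [sub_adj_lr]; simp [ed]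
  have hyadj : ∀ i, (SubdivideEdges G₀ F).Adj (Sum.inl (yy i)) (Sum.inr (ed i)) := fun i => by
    rw [sub_adj_lr]; simp [ed]
  have key : ∀ s t, (Γ Finset.univ).Adj s t → Conn (SubdivideEdges G₀ F) (C s) ∧
      Tch (SubdivideEdges G₀ F) (C s) (C t) := by
    rintro s t (h5 | h5)
    · obtain ⟨a, b, rfl, rfl, hab, hno⟩ := hE₀ _ _ h5
      refine ⟨hCφ a, Sum.inl a, hφmem a, Sum.inl b, hφmem b, ?_⟩
      rw [sub_adj_ll]
      exact ⟨hab, by rintro ⟨i, hi⟩; exact hno i hi⟩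
    · rw [SimpleGraph.iSup_adj] at h5
      obtain ⟨i, h5⟩ := h5
      simp only [Finset.mem_univ, if_true] at h5
      by_cases hi : nt i
      · simp only [Q, hi, if_true, P3_adj] at h5
        rcases h5.2 with ⟨rfl, rfl⟩ | ⟨rfl, rfl⟩ | ⟨rfl, rfl⟩ | ⟨rfl, rfl⟩
        · exact ⟨hCφ _, _, hφmem _, _, hhmem i hi, hxadj i⟩
        · exact ⟨hCh i hi, _, hhmem i hi, _, hφmem _, (hxadj i).symm⟩
        · exact ⟨hCh i hi, _, hhmem i hi, _, hφmem _, (hyadj i).symm⟩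
        · exact ⟨hCφ _, _, hφmem _, _, hhmem i hi, hyadj i⟩
      · simp only [Q, hi, if_false] at h5
        have hs := (H i).edge_vert h5
        have ht := (H i).edge_vert h5.symm
        have hi' : ∀ v ∈ (H i).verts, v = φ (xx i) ∨ v = φ (yy i) := by
          intro v hv
          by_contra hn
          push Not at hn
          exact hi ⟨v, hv, hn⟩
        have hmem : Sum.inr (ed i) ∈ C (φ (xx i)) := Or.inr ⟨i, rfl, Or.inr ⟨hi, rfl⟩⟩
        rcases hi' s hs with rfl | rfl <;> rcases hi' t ht with rfl | rfl
        · exact absurd rfl h5.ne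
        · exact ⟨hCφ _, _, hmem, _, hφmem _, (hyadj i).symm⟩
        · exact ⟨hCφ _, _, hφmem _, _, hmem, hyadj i⟩
        · exact absurd rfl h5.ne
  refine hfin.trans' nice_K24.noniso C ?_ (fun a b hab => (key a b hab).1) (fun a b hab => (key a b hab).2)
  rintro v w z (⟨a, rfl, ha⟩ | ⟨i, rfl, hi⟩) (⟨b, hb, hb'⟩ | ⟨j, hj, hj'⟩)
  · cases hb; rw [← ha, ← hb']
  · cases hj
  · cases hb
  · cases hed _ _ (Sum.inr_injective hj)
    rcases hi with ⟨h5, h6⟩ | ⟨h5, h6⟩ <;> rcases hj' with ⟨h7, h8⟩ | ⟨h7, h8⟩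
    · rw [h6, h8]
    · exact absurd h5 h7
    · exact absurd h7 h5
    · rw [h6, h8]

end Suff

open SimpleGraph

/-! ### Part 5: rooted `K_{2,2}` minors and outerplanar pieces -/

section Rooted
variable {V : Type*} {G : SimpleGraph V}

/-- `(R1, R2; S1, S2)` is a `K_{2,2}` minor inside `X` rooted at `x ∈ R1`, `y ∈ R2`. -/
structure RK (G : SimpleGraph V) (X : Set V) (x y : V) (R1 R2 S1 S2 : Set V) : Prop where
  r1 : R1 ⊆ X
  r2 : R2 ⊆ X
  s1 : S1 ⊆ X
  s2 : S2 ⊆ X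
  d12 : ∀ v, v ∈ R1 → v ∉ R2
  ds12 : ∀ v, v ∈ S1 → v ∉ S2
  d11 : ∀ v, v ∈ R1 → v ∉ S1
  d1s : ∀ v, v ∈ R1 → v ∉ S2
  d21 : ∀ v, v ∈ R2 → v ∉ S1
  d22 : ∀ v, v ∈ R2 → v ∉ S2
  hx : x ∈ R1
  hy : y ∈ R2
  cr1 : Conn G R1
  cr2 : Conn G R2
  cs1 : Conn G S1
  cs2 : Conn G S2
  t11 : Tch G S1 R1
  t12 : Tch G S1 R2
  t21 : Tch G S2 R1
  t22 : Tch G S2 R2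

def RK22 (G : SimpleGraph V) (X : Set V) (x y : V) : Prop := ∃ R1 R2 S1 S2, RK G X x y R1 R2 S1 S2

theorem RK.swap {X : Set V} {x y : V} {R1 R2 S1 S2 : Set V} (h : RK G X x y R1 R2 S1 S2) :
    RK G X y x R2 R1 S1 S2 :=
  ⟨h.r2, h.r1, h.s1, h.s2, fun v a b => h.d12 v b a, h.ds12, h.d21, h.d22, h.d11, h.d1s, h.hy, h.hx,
    h.cr2, h.cr1, h.cs1, h.cs2, h.t12, h.t11, h.t22, h.t21⟩

theorem RK.swapS {X : Set V} {x y : V} {R1 R2 S1 S2 : Set V} (h : RK G X x y R1 R2 S1 S2) :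
    RK G X x y R1 R2 S2 S1 :=
  ⟨h.r1, h.r2, h.s2, h.s1, h.d12, fun v a b => h.ds12 v b a, h.d1s, h.d11, h.d22, h.d21, h.hx, h.hy,
    h.cr1, h.cr2, h.cs2, h.cs1, h.t21, h.t22, h.t11, h.t12⟩

theorem RK22.swap {X : Set V} {x y : V} (h : RK22 G X x y) : RK22 G X y x := by
  obtain ⟨R1, R2, S1, S2, h⟩ := h
  exact ⟨_, _, _, _, h.swap⟩

theorem exists_min {α : Type*} (p : α → Prop) (f : α → ℕ) (h : ∃ a, p a) :
    ∃ a, p a ∧ ∀ b, p b → f a ≤ f b := by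
  obtain ⟨a, ha, hm⟩ := (measure f).wf.has_min {a | p a} h
  exact ⟨a, ha, fun b hb => not_lt.1 (hm b hb)⟩

theorem lemmaA [Finite V] (G : SimpleGraph V) (y : V) : ∀ (N : ℕ) (X : Set V) (x : V), X.ncard ≤ N →
    x ∈ X → y ∈ X → x ≠ y → Conn G X →
    (∀ c ∈ X, ∀ P : Set V, P ⊆ X \ {c} → P.Nonempty → Clo G (X \ {c}) P → x ∈ P ∨ y ∈ P) →
    ¬ RK22 G X x y → ∃ n u, OL G X x y n u := by
  intro N
  induction N with
  | zero =>
    intro X x hN hx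
    have := (Set.ncard_pos (Set.toFinite X)).2 ⟨x, hx⟩
    omega
  | succ N ih =>
    intro X x hN hxX hyX hxy hX hC hR
    set J := X \ {x} with hJdef
    have hyJ : y ∈ J := ⟨hyX, fun h => hxy h.symm⟩
    have hJX : J ⊆ X := Set.sdiff_subset
    have hxJ : x ∉ J := fun h => h.2 rfl
    have hJ : Conn G J := conn_of_base J y hyJ fun P hP hPn hcl => by
      rcases hC x hxX P hP hPn hcl with h | h
      · exact absurd (hP h) hxJ
      · exact h
    by_cases hJy : ∀ z ∈ J, z = y
    · refine ⟨1, fun i => if i = 0 then x else y, ?_, by simp, by simp, ?_, ?_, ?_⟩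
      · intro i j hi hj hij
        have h1 : i = 0 ∨ i = 1 := by omega
        have h2 : j = 0 ∨ j = 1 := by omega
        rcases h1 with rfl | rfl <;> rcases h2 with rfl | rfl <;> simp_all
      · intro v
        constructor
        · intro hv
          by_cases h : v = x
          · exact ⟨0, by omega, by simp [h]⟩
          · exact ⟨1, by omega, by simp [hJy v ⟨hv, h⟩]⟩
        · rintro ⟨i, -, rfl⟩
          by_cases h : i = 0 <;> simp [h, hxX, hyX]
      · intro i hi
        have : i = 0 := by omega
        subst this
        obtain ⟨u, _, hu, w, hw, hw', huw⟩ := hX.exit (D := {x}) ⟨x, hxX, rfl⟩ ⟨y, hyX, fun h => hxy h.symm⟩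
        have h1 : u = x := hu
        have h2 := hJy w ⟨hw, hw'⟩
        subst h1 h2
        simpa using huw
      · intro i k j m h1 h2 h3 h4; omega
    · push Not at hJy
      obtain ⟨z, hzJ, hzy⟩ := hJy
      let good : V × Set V → Prop := fun q => q.1 ∈ J ∧ q.2 ⊆ J \ {q.1} ∧ q.2.Nonempty ∧
        Clo G (J \ {q.1}) q.2 ∧ y ∉ q.2
      obtain ⟨⟨c, D⟩, ⟨hcJ, hDJ, hDn, hDcl, hyD⟩, hmin⟩ := exists_min good (fun q => q.2.ncard)
        ⟨(y, J \ {y}), hyJ, le_rfl, ⟨z, hzJ, hzy⟩, fun u _ w hw _ => hw, fun h => h.2 rfl⟩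
      simp only at hcJ hDJ hDn hDcl hyD
      have hmin' : ∀ c' D', c' ∈ J → D' ⊆ J \ {c'} → D'.Nonempty → Clo G (J \ {c'}) D' → y ∉ D' →
          D.ncard ≤ D'.ncard := fun c' D' h1 h2 h3 h4 h5 => hmin (c', D') ⟨h1, h2, h3, h4, h5⟩
      have hcD : c ∉ D := fun h => (hDJ h).2 rfl
      have hDJ' : D ⊆ J := fun v h => (hDJ h).1
      have hDc : Conn G D := by
        obtain ⟨D', hD', hsub⟩ := exists_comp_in hDJ hDn hDcl
        have := hmin' c D' hcJ hD'.1 hD'.2.1.1 hD'.2.2 (fun h => hyD (hsub h))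
        have := Set.eq_of_subset_of_ncard_le hsub this (Set.toFinite _)
        rw [← this]; exact hD'.2.1
      -- every good set has a neighbour of x
      have hnb : ∀ c' D', c' ∈ J → D' ⊆ J \ {c'} → D'.Nonempty → Clo G (J \ {c'}) D' → y ∉ D' →
          ∃ x' ∈ D', G.Adj x' x := by
        intro c' D' h1 h2 h3 h4 h5
        by_contra hn
        push Not at hn
        rcases hC c' (hJX h1) D' (fun v hv => ⟨hJX (h2 hv).1, (h2 hv).2⟩) h3 (by
          intro u hu w hw huw
          refine h4 u hu w ⟨⟨hw.1, ?_⟩, hw.2⟩ huw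
          rintro rfl
          exact hn u hu huw) with h | h
        · exact hxJ (h2 h).1
        · exact h5 h
      obtain ⟨x', hx'D, hx'x⟩ := hnb c D hcJ hDJ hDn hDcl hyD
      have hx'y : x' ≠ y := fun h => hyD (h ▸ hx'D)
      have hK : Conn G (J \ D) := hJ.diff c hcJ hcD fun u hu w hw huw => by
        by_cases h : w = c
        · exact Or.inr h
        · exact Or.inl (hDcl u hu w ⟨hw, h⟩ huw)
      have hDcadj : ∃ u ∈ D, G.Adj u c := by
        obtain ⟨u, _, hu, w, hw, hw', huw⟩ := hJ.exit (D := D) ⟨x', hDJ' hx'D, hx'D⟩ ⟨y, hyJ, hyD⟩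
        by_cases h : w = c
        · exact ⟨u, hu, h ▸ huw⟩
        · exact absurd (hDcl u hu w ⟨hw, h⟩ huw) hw'
      have hCJ : ∀ c ∈ J, ∀ P : Set V, P ⊆ J \ {c} → P.Nonempty → Clo G (J \ {c}) P → x' ∈ P ∨ y ∈ P := by
        intro c' hc' P hP hPn hPcl
        by_contra hn
        push Not at hn
        obtain ⟨D', hD', hsub⟩ := exists_comp_in hP hPn hPcl
        have hyD' : y ∉ D' := fun h => hn.2 (hsub h)
        have hxpDp : x' ∉ D' := fun h => hn.1 (hsub h)
        have hle := hmin' c' D' hc' hD'.1 hD'.2.1.1 hD'.2.2 hyD'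
        have hcpDp : c' ∉ D' := fun h => (hD'.1 h).2 rfl
        by_cases hc'D : c' ∈ D
        · have hss : D' ⊆ D := by
            intro v hv
            by_contra hvD
            exact hyD' (hK.sub_of_clo (S := J \ {c'})
              (fun w hw => ⟨hw.1, fun h => hw.2 (by rw [show w = c' from h]; exact hc'D)⟩) hD'.2.2
              ⟨v, ⟨(hD'.1 hv).1, hvD⟩, hv⟩ ⟨hyJ, hyD⟩)
          have : D' ⊂ D := ⟨hss, fun h => hcpDp (h hc'D)⟩
          have := Set.ncard_lt_ncard this (Set.toFinite _)
          omega
        · have hdis : ∀ v, v ∈ D → v ∉ D' := by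
            intro v hv hv'
            exact hxpDp (hDc.sub_of_clo (S := J \ {c'})
              (fun w hw => ⟨hDJ' hw, fun h => hc'D (by rw [← show w = c' from h]; exact hw)⟩) hD'.2.2
              ⟨v, hv, hv'⟩ hx'D)
          obtain ⟨p, hpD, hpc⟩ := hDcadj
          have hcD' : c ∉ D' := by
            intro h
            refine hdis p hpD (hD'.2.2 c h p ⟨hDJ' hpD, ?_⟩ hpc.symm)
            intro h5
            exact hc'D (by rw [← show p = c' from h5]; exact hpD)
          have hR2 : Conn G ((J \ D) \ D') := hK.diff c' ⟨hc', hc'D⟩ hcpDp fun u hu w hw huw => by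
            by_cases h : w = c'
            · exact Or.inr h
            · exact Or.inl (hD'.2.2 u hu w ⟨hw.1, h⟩ huw)
          obtain ⟨q, hqD', hqx⟩ := hnb c' D' hc' hD'.1 hD'.2.1.1 hD'.2.2 hyD'
          have hDc' : ∃ u ∈ D', G.Adj u c' := by
            obtain ⟨u, _, hu, w, hw, hw', huw⟩ := hJ.exit (D := D') ⟨q, (hD'.1 hqD').1, hqD'⟩ ⟨y, hyJ, hyD'⟩
            by_cases h : w = c'
            · exact ⟨u, hu, h ▸ huw⟩
            · exact absurd (hD'.2.2 u hu w ⟨hw, h⟩ huw) hw'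
          obtain ⟨r, hr, hrc⟩ := hDc'
          refine hR ⟨{x}, (J \ D) \ D', D, D', ?_⟩
          refine ⟨by simpa using hxX, fun v h => hJX h.1.1, fun v h => hJX (hDJ' h),
            fun v h => hJX (hD'.1 h).1, ?_, hdis, ?_, ?_, fun v h => h.1.2, fun v h => h.2, rfl,
            ⟨⟨hyJ, hyD⟩, hyD'⟩, conn_singleton _, hR2, hDc, hD'.2.1, ⟨x', hx'D, x, rfl, hx'x⟩,
            ⟨p, hpD, c, ⟨⟨hcJ, hcD⟩, hcD'⟩, hpc⟩, ⟨q, hqD', x, rfl, hqx⟩,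
            ⟨r, hr, c', ⟨⟨hc', hc'D⟩, hcpDp⟩, hrc⟩⟩
          · rintro v rfl h; exact hxJ h.1.1
          · rintro v rfl h; exact hxJ (hDJ' h)
          · rintro v rfl h; exact hxJ (hD'.1 h).1
      have hRJ : ¬ RK22 G J x' y := by
        rintro ⟨R1, R2, S1, S2, h⟩
        refine hR ⟨insert x R1, R2, S1, S2, ?_⟩
        refine ⟨?_, h.r2.trans hJX, h.s1.trans hJX, h.s2.trans hJX, ?_, h.ds12, ?_, ?_, h.d21, h.d22, Or.inl rfl, h.hy,
          h.cr1.insert1 x ⟨x', h.hx, hx'x.symm⟩, h.cr2, h.cs1, h.cs2, h.t11.mono le_rfl (Set.subset_insert _ _),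
          h.t12, h.t21.mono le_rfl (Set.subset_insert _ _), h.t22⟩
        · exact Set.insert_subset hxX (h.r1.trans hJX)
        · rintro v (rfl | hv) hv'
          · exact hxJ (h.r2 hv')
          · exact h.d12 v hv hv'
        · rintro v (rfl | hv) hv'
          · exact hxJ (h.s1 hv')
          · exact h.d11 v hv hv'
        · rintro v (rfl | hv) hv'
          · exact hxJ (h.s2 hv')
          · exact h.d1s v hv hv'
      have hcard : J.ncard ≤ N := by
        have : J ⊂ X := ⟨hJX, fun h => hxJ (h hxX)⟩
        have := Set.ncard_lt_ncard this (Set.toFinite _)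
        omega
      obtain ⟨n, u', hu⟩ := ih J x' hcard (hDJ' hx'D) hyJ hx'y hJ hCJ hRJ
      let u : ℕ → V := fun i => if i = 0 then x else u' (i - 1)
      have us : ∀ i, u (i+1) = u' i := fun i => by simp [u]
      have u0 : u 0 = x := by simp [u]
      have hmemJ : ∀ i, i ≤ n → u' i ∈ J := fun i hi => (hu.mem _).2 ⟨i, hi, rfl⟩
      refine ⟨n+1, u, ?_, u0, by rw [us, hu.un], ?_, ?_, ?_⟩
      · intro i j hi hj hij
        rcases i with _ | i <;> rcases j with _ | j
        · rfl
        · rw [u0, us] at hij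
          exact absurd (hij ▸ hmemJ j (by omega)) hxJ
        · rw [u0, us] at hij
          exact absurd (hij ▸ hmemJ i (by omega)) hxJ
        · rw [us, us] at hij
          rw [hu.inj i j (by omega) (by omega) hij]
      · intro v
        constructor
        · intro hv
          by_cases h : v = x
          · exact ⟨0, by omega, by rw [u0, h]⟩
          · obtain ⟨i, hi, hiv⟩ := (hu.mem v).1 ⟨hv, h⟩
            exact ⟨i+1, by omega, by rw [us, hiv]⟩
        · rintro ⟨i, hi, rfl⟩
          rcases i with _ | i
          · rw [u0]; exact hxX
          · rw [us]; exact hJX (hmemJ i (by omega))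
      · intro i hi
        rcases i with _ | i
        · rw [u0, us, hu.u0]; exact hx'x.symm
        · rw [us, us]; exact hu.chain i (by omega)
      · rintro i k j m h1 h2 h3 h4 ⟨h5, h6⟩
        obtain ⟨k, rfl⟩ : ∃ k', k = k' + 1 := ⟨k - 1, by omega⟩
        obtain ⟨j, rfl⟩ : ∃ k', j = k' + 1 := ⟨j - 1, by omega⟩
        obtain ⟨m, rfl⟩ : ∃ k', m = k' + 1 := ⟨m - 1, by omega⟩
        rw [us, us] at h6
        rcases i with _ | i
        · rw [u0, us] at h5
          have cs : ∀ a b, a ≤ b → b ≤ n → Conn G (u' '' Set.Icc a b) := fun a b hab hb =>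
            conn_seg u' a b hab fun t _ ht => hu.chain t (by omega)
          have ss : ∀ a b, b ≤ n → u' '' Set.Icc a b ⊆ J := by
            rintro a b hb _ ⟨t, ht, rfl⟩
            exact hmemJ t (by have := ht.2; omega)
          have dd : ∀ a b a' b', b ≤ n → b' ≤ n → (b < a' ∨ b' < a) → ∀ v, v ∈ u' '' Set.Icc a b →
              v ∉ u' '' Set.Icc a' b' := by
            rintro a b a' b' hb hb' hor _ ⟨t, ⟨ht1, ht2⟩, rfl⟩ ⟨t', ⟨ht1', ht2'⟩, he⟩
            have := hu.inj t' t (by omega) (by omega) he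
            omega
          have mm : ∀ a b t, a ≤ t → t ≤ b → u' t ∈ u' '' Set.Icc a b := fun a b t h h' => ⟨t, ⟨h, h'⟩, rfl⟩
          have xx : ∀ a b, b ≤ n → ∀ v, v ∈ ({x} : Set V) → v ∉ u' '' Set.Icc a b := by
            rintro a b hb v rfl h
            exact hxJ (ss a b hb h)
          refine hR ⟨{x}, u' '' Set.Icc m n, u' '' Set.Icc j (m-1), u' '' Set.Icc 0 k, ?_⟩
          refine ⟨by simpa using hxX, (ss _ _ le_rfl).trans hJX, (ss _ _ (by omega)).trans hJX,
            (ss _ _ (by omega)).trans hJX, xx _ _ (by omega), dd _ _ _ _ (by omega) (by omega) (by omega),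
            xx _ _ (by omega), xx _ _ (by omega), dd _ _ _ _ (by omega) (by omega) (by omega),
            dd _ _ _ _ (by omega) (by omega) (by omega), rfl, ?_, conn_singleton _, cs _ _ (by omega) (by omega),
            cs _ _ (by omega) (by omega), cs _ _ (by omega) (by omega), ?_, ?_, ?_, ?_⟩
          · rw [← hu.un]; exact mm _ _ _ (by omega) le_rfl
          · exact ⟨u' j, mm _ _ _ le_rfl (by omega), x, rfl, h5.symm⟩
          · refine ⟨u' (m-1), mm _ _ _ (by omega) le_rfl, u' m, mm _ _ _ le_rfl (by omega), ?_⟩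
            have := hu.chain (m-1) (by omega)
            rwa [Nat.sub_add_cancel (by omega)] at this
          · refine ⟨u' 0, mm _ _ _ le_rfl (by omega), x, rfl, ?_⟩
            rw [hu.u0]; exact hx'x
          · exact ⟨u' k, mm _ _ _ (by omega) le_rfl, u' m, mm _ _ _ le_rfl (by omega), h6⟩
        · rw [us, us] at h5
          exact hu.nc i k j m (by omega) (by omega) (by omega) (by omega) ⟨h5, h6⟩

/-- `A` is attached to the rest of the graph only at `x`, `y`. -/
structure Att (G : SimpleGraph V) (A : Set V) (x y : V) : Prop where
  ne : x ≠ y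
  non : A.Nonempty
  hx : x ∉ A
  hy : y ∉ A
  nb : ∀ u ∈ A, ∀ w, G.Adj u w → w ∈ A ∨ w = x ∨ w = y

theorem Att.swap {A : Set V} {x y : V} (h : Att G A x y) : Att G A y x :=
  ⟨h.ne.symm, h.non, h.hy, h.hx, fun u hu w hw => by have := h.nb u hu w hw; tauto⟩

theorem Att.adjx (hG : IsBlock G) {A : Set V} {x y : V} (h : Att G A x y) : ∃ u ∈ A, G.Adj u x := by
  by_contra hn
  push Not at hn
  refine h.hx (hG.cut y A h.hy h.non ?_ x h.ne)
  intro u hu w hw huw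
  rcases h.nb u hu w huw with h1 | rfl | rfl
  · exact h1
  · exact absurd huw (hn u hu)
  · exact absurd rfl hw

theorem Att.adjy (hG : IsBlock G) {A : Set V} {x y : V} (h : Att G A x y) : ∃ u ∈ A, G.Adj u y :=
  h.swap.adjx hG

/-- Closed pieces of attached sets are attached. -/
theorem Att.part {A P : Set V} {x y : V} (h : Att G A x y) (hP : P ⊆ A) (hPn : P.Nonempty) (hcl : Clo G A P) :
    Att G P x y :=
  ⟨h.ne, hPn, fun h' => h.hx (hP h'), fun h' => h.hy (hP h'), fun u hu w huw => by
    rcases h.nb u (hP hu) w huw with h1 | h1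
    · exact Or.inl (hcl u hu w h1 huw)
    · exact Or.inr h1⟩

theorem Att.rk_of_split (hG : IsBlock G) {A P Q : Set V} {x y : V} (hP : Att G P x y) (hQ : Att G Q x y)
    (hPA : P ⊆ A) (hQA : Q ⊆ A) (hd : ∀ v, v ∈ P → v ∉ Q) : RK22 G (insert x (insert y A)) x y := by
  obtain ⟨D, hD, hDP⟩ := exists_comp_in (G := G) (le_refl P) hP.non (fun _ _ w hw _ => hw)
  obtain ⟨E, hE, hEP⟩ := exists_comp_in (G := G) (le_refl Q) hQ.non (fun _ _ w hw _ => hw)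
  have aD := hP.part hD.1 hD.2.1.1 hD.2.2
  have aE := hQ.part hE.1 hE.2.1.1 hE.2.2
  obtain ⟨p, hp, hpx⟩ := aD.adjx hG
  obtain ⟨p', hp', hpy⟩ := aD.adjy hG
  obtain ⟨q, hq, hqx⟩ := aE.adjx hG
  obtain ⟨q', hq', hqy⟩ := aE.adjy hG
  refine ⟨{x}, {y}, D, E, ?_⟩
  refine ⟨by simp, by simp, fun v hv => Or.inr (Or.inr (hPA (hDP hv))), fun v hv => Or.inr (Or.inr (hQA (hEP hv))),
    ?_, fun v hv hv' => hd v (hDP hv) (hEP hv'), ?_, ?_, ?_, ?_, rfl, rfl, conn_singleton _, conn_singleton _,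
    hD.2.1, hE.2.1, ⟨p, hp, x, rfl, hpx⟩, ⟨p', hp', y, rfl, hpy⟩, ⟨q, hq, x, rfl, hqx⟩, ⟨q', hq', y, rfl, hqy⟩⟩
  · rintro v rfl h; exact hP.ne h
  · rintro v rfl h; exact aD.hx h
  · rintro v rfl h; exact aE.hx h
  · rintro v rfl h; exact aD.hy h
  · rintro v rfl h; exact aE.hy h

theorem Att.conn (hG : IsBlock G) {A : Set V} {x y : V} (h : Att G A x y)
    (hR : ¬ RK22 G (insert x (insert y A)) x y) : Conn G A := by
  refine ⟨h.non, fun P hPA hPn hcl v hv => ?_⟩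
  by_contra hvP
  refine hR (Att.rk_of_split hG (h.part hPA hPn hcl) (h.part (P := A \ P) Set.sdiff_subset ⟨v, hv, hvP⟩ ?_) hPA
    Set.sdiff_subset fun w hw hw' => hw'.2 hw)
  intro u hu w hw huw
  exact ⟨hw, fun h' => hu.2 (hcl w h' u hu.1 huw.symm)⟩

theorem Att.ol [Finite V] (hG : IsBlock G) {A : Set V} {x y : V} (h : Att G A x y)
    (hR : ¬ RK22 G (insert x (insert y A)) x y) : ∃ n u, OL G (insert x (insert y A)) x y n u := by
  have hc := h.conn hG hR
  obtain ⟨p, hp, hpx⟩ := h.adjx hG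
  obtain ⟨q, hq, hqy⟩ := h.adjy hG
  refine lemmaA G y _ _ x le_rfl (Or.inl rfl) (Or.inr (Or.inl rfl)) h.ne
    ((hc.insert1 y ⟨q, hq, hqy.symm⟩).insert1 x ⟨p, Or.inr hp, hpx.symm⟩) ?_ hR
  intro c hc P hP hPn hcl
  by_contra hn
  push Not at hn
  have hPA : P ⊆ A := by
    intro v hv
    rcases (hP hv).1 with rfl | rfl | h
    · exact absurd hv hn.1
    · exact absurd hv hn.2
    · exact h
  have hcut := hG.cut c P (fun h => (hP h).2 rfl) hPn (by
    intro u hu w hw huw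
    refine hcl u hu w ⟨?_, hw⟩ huw
    rcases h.nb u (hPA hu) w huw with h | rfl | rfl
    · exact Or.inr (Or.inr h)
    · exact Or.inl rfl
    · exact Or.inr (Or.inl rfl))
  by_cases hcx : c = x
  · exact hn.2 (hcut y (by rw [hcx]; exact h.ne.symm))
  · exact hn.1 (hcut x (Ne.symm hcx))

end Rooted

open SimpleGraph

/-! ### Part 6: two-separations -/

section TwoSep
variable {V : Type*} {G : SimpleGraph V}

theorem mk_K24 (R : Fin 2 → Set V) (T : Fin 4 → Set V) (cR : ∀ i, Conn G (R i)) (cT : ∀ i, Conn G (T i))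
    (hRR : ∀ v, v ∈ R 0 → v ∉ R 1) (hRT : ∀ i j v, v ∈ R i → v ∉ T j)
    (hTT : ∀ i j v, v ∈ T i → v ∈ T j → i = j) (ht : ∀ i j, Tch G (T j) (R i)) : IsMinor K24 G := by
  rw [isMinor_iff]
  refine ⟨Sum.elim R T, ?_, ?_, ?_⟩
  · rintro (i | i)
    · exact cR i
    · exact cT i
  · rintro (i | i) (j | j) v hi hj
    · simp only [Sum.elim_inl] at hi hj
      fin_cases i <;> fin_cases j
      · rfl
      · exact absurd hj (hRR v hi)
      · exact absurd hi (hRR v hj)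
      · rfl
    · exact absurd hj (hRT i j v hi)
    · exact absurd hi (hRT j i v hj)
    · rw [hTT i j v hi hj]
  · rintro (i | i) (j | j) h
    · simp [K24] at h
    · exact (ht i j).symm
    · exact ht j i
    · simp [K24] at h

theorem rk_minor {A B : Set V} {x y : V} (hd : ∀ v, v ∈ A → v ∉ B) (hAx : x ∉ A) (hAy : y ∉ A)
    (hBx : x ∉ B) (hBy : y ∉ B)
    (hA : RK22 G (insert x (insert y A)) x y) (hB : RK22 G (insert x (insert y B)) x y) : IsMinor K24 G := by
  obtain ⟨R1, R2, S1, S2, h⟩ := hA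
  obtain ⟨Q1, Q2, T1, T2, k⟩ := hB
  have xr2 : x ∉ R2 := h.d12 x h.hx
  have yr1 : y ∉ R1 := fun h' => h.d12 y h' h.hy
  have xq2 : x ∉ Q2 := k.d12 x k.hx
  have yq1 : y ∉ Q1 := fun h' => k.d12 y h' k.hy
  have R1A : ∀ v, v ∈ R1 → v = x ∨ v ∈ A := fun v hv => by
    rcases h.r1 hv with h1 | h1 | h1
    · exact Or.inl h1
    · exact absurd (h1 ▸ hv) yr1
    · exact Or.inr h1
  have R2A : ∀ v, v ∈ R2 → v = y ∨ v ∈ A := fun v hv => by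
    rcases h.r2 hv with h1 | h1 | h1
    · exact absurd (h1 ▸ hv) xr2
    · exact Or.inl h1
    · exact Or.inr h1
  have Q1B : ∀ v, v ∈ Q1 → v = x ∨ v ∈ B := fun v hv => by
    rcases k.r1 hv with h1 | h1 | h1
    · exact Or.inl h1
    · exact absurd (h1 ▸ hv) yq1
    · exact Or.inr h1
  have Q2B : ∀ v, v ∈ Q2 → v = y ∨ v ∈ B := fun v hv => by
    rcases k.r2 hv with h1 | h1 | h1
    · exact absurd (h1 ▸ hv) xq2
    · exact Or.inl h1
    · exact Or.inr h1
  have S1A : ∀ v, v ∈ S1 → v ∈ A := fun v hv => by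
    rcases h.s1 hv with h1 | h1 | h1
    · exact absurd (h1 ▸ hv) (h.d11 x h.hx)
    · exact absurd (h1 ▸ hv) (h.d21 y h.hy)
    · exact h1
  have S2A : ∀ v, v ∈ S2 → v ∈ A := fun v hv => by
    rcases h.s2 hv with h1 | h1 | h1
    · exact absurd (h1 ▸ hv) (h.d1s x h.hx)
    · exact absurd (h1 ▸ hv) (h.d22 y h.hy)
    · exact h1
  have T1B : ∀ v, v ∈ T1 → v ∈ B := fun v hv => by
    rcases k.s1 hv with h1 | h1 | h1
    · exact absurd (h1 ▸ hv) (k.d11 x k.hx)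
    · exact absurd (h1 ▸ hv) (k.d21 y k.hy)
    · exact h1
  have T2B : ∀ v, v ∈ T2 → v ∈ B := fun v hv => by
    rcases k.s2 hv with h1 | h1 | h1
    · exact absurd (h1 ▸ hv) (k.d1s x k.hx)
    · exact absurd (h1 ▸ hv) (k.d22 y k.hy)
    · exact h1
  have hxy : x ≠ y := fun e => xr2 (e ▸ h.hy)
  -- cross disjointness
  have c1 : ∀ v, v ∈ R1 → v ∉ B := fun v hv hb => by
    rcases R1A v hv with rfl | ha
    · exact hBx hb
    · exact hd v ha hb
  have c2 : ∀ v, v ∈ R2 → v ∉ B := fun v hv hb => by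
    rcases R2A v hv with rfl | ha
    · exact hBy hb
    · exact hd v ha hb
  have c3 : ∀ v, v ∈ Q1 → v ∉ A := fun v hv hb => by
    rcases Q1B v hv with rfl | ha
    · exact hAx hb
    · exact hd v hb ha
  have c4 : ∀ v, v ∈ Q2 → v ∉ A := fun v hv hb => by
    rcases Q2B v hv with rfl | ha
    · exact hAy hb
    · exact hd v hb ha
  refine mk_K24 ![R1 ∪ Q1, R2 ∪ Q2] ![S1, S2, T1, T2] ?_ ?_ ?_ ?_ ?_ ?_
  · intro i
    fin_cases i
    · exact h.cr1.union k.cr1 ⟨x, h.hx, k.hx⟩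
    · exact h.cr2.union k.cr2 ⟨y, h.hy, k.hy⟩
  · intro i
    fin_cases i
    · exact h.cs1
    · exact h.cs2
    · exact k.cs1
    · exact k.cs2
  · rintro v (hv | hv) (hv' | hv')
    · exact h.d12 v hv hv'
    · rcases Q2B v hv' with rfl | hb
      · exact yr1 hv
      · exact c1 v hv hb
    · rcases R2A v hv' with rfl | ha
      · exact yq1 hv
      · exact c3 v hv ha
    · exact k.d12 v hv hv'
  · intro i j v hi hj
    fin_cases i
    · rcases hi with hi | hi
      · fin_cases j
        · exact h.d11 v hi hj
        · exact h.d1s v hi hj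
        · exact c1 v hi (T1B v hj)
        · exact c1 v hi (T2B v hj)
      · fin_cases j
        · exact c3 v hi (S1A v hj)
        · exact c3 v hi (S2A v hj)
        · exact k.d11 v hi hj
        · exact k.d1s v hi hj
    · rcases hi with hi | hi
      · fin_cases j
        · exact h.d21 v hi hj
        · exact h.d22 v hi hj
        · exact c2 v hi (T1B v hj)
        · exact c2 v hi (T2B v hj)
      · fin_cases j
        · exact c4 v hi (S1A v hj)
        · exact c4 v hi (S2A v hj)
        · exact k.d21 v hi hj
        · exact k.d22 v hi hj
  · have hs : ∀ v, v ∈ S1 → v ∉ S2 := h.ds12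
    have ht : ∀ v, v ∈ T1 → v ∉ T2 := k.ds12
    intro i j v hi hj
    fin_cases i <;> fin_cases j <;> first | rfl | skip
    · exact absurd hj (hs v hi)
    · exact absurd (T1B v hj) (hd v (S1A v hi))
    · exact absurd (T2B v hj) (hd v (S1A v hi))
    · exact absurd hi (hs v hj)
    · exact absurd (T1B v hj) (hd v (S2A v hi))
    · exact absurd (T2B v hj) (hd v (S2A v hi))
    · exact absurd (T1B v hi) (hd v (S1A v hj))
    · exact absurd (T1B v hi) (hd v (S2A v hj))
    · exact absurd hj (ht v hi)
    · exact absurd (T2B v hi) (hd v (S1A v hj))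
    · exact absurd (T2B v hi) (hd v (S2A v hj))
    · exact absurd hi (ht v hj)
  · intro i j
    fin_cases i <;> fin_cases j
    · exact h.t11.mono le_rfl Set.subset_union_left
    · exact h.t21.mono le_rfl Set.subset_union_left
    · exact k.t11.mono le_rfl Set.subset_union_right
    · exact k.t21.mono le_rfl Set.subset_union_right
    · exact h.t12.mono le_rfl Set.subset_union_left
    · exact h.t22.mono le_rfl Set.subset_union_left
    · exact k.t12.mono le_rfl Set.subset_union_right
    · exact k.t22.mono le_rfl Set.subset_union_right

/-- The induced subgraph on `X`. -/
abbrev ind (G : SimpleGraph V) (X : Set V) : G.Subgraph := (⊤ : G.Subgraph).induce X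

theorem ind_adj {X : Set V} {u v : V} : (ind G X).Adj u v ↔ u ∈ X ∧ v ∈ X ∧ G.Adj u v := by
  simp [ind]

theorem ind_sc {X : Set V} {u v : V} : (ind G X).spanningCoe.Adj u v ↔ u ∈ X ∧ v ∈ X ∧ G.Adj u v := by
  simp [ind]

theorem OL.ind {X : Set V} {x y : V} {n u} (h : OL G X x y n u) : OL (ind G X).spanningCoe X x y n u := by
  refine ⟨h.inj, h.u0, h.un, h.mem, ?_, ?_⟩
  · intro i hi
    rw [ind_sc]
    exact ⟨(h.mem _).2 ⟨i, by omega, rfl⟩, (h.mem _).2 ⟨i+1, by omega, rfl⟩, h.chain i hi⟩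
  · intro i k j m h1 h2 h3 h4 h5
    rw [ind_sc, ind_sc] at h5
    exact h.nc i k j m h1 h2 h3 h4 ⟨h5.1.2.2, h5.2.2.2⟩

def CondI (G : SimpleGraph V) : Prop := MinorFree (completeGraph (Fin 4)) G ∧
  MinorFree (completeBipartiteGraph (Fin 2) (Fin 3)) G

def CondII (G : SimpleGraph V) : Prop := ∃ x y : V, x ≠ y ∧ ∃ H₁ H₂ H₃ : G.Subgraph,
        XYOuterplanar H₁.spanningCoe H₁.verts x y ∧
        XYOuterplanar H₂.spanningCoe H₂.verts x y ∧
        XYOuterplanar H₃.spanningCoe H₃.verts x y ∧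
        3 ≤ H₁.verts.ncard ∧ 3 ≤ H₂.verts.ncard ∧ 3 ≤ H₃.verts.ncard ∧
        H₁.verts ∩ H₂.verts = {x, y} ∧ H₁.verts ∩ H₃.verts = {x, y} ∧
        H₂.verts ∩ H₃.verts = {x, y} ∧
        (H₁ ⊔ H₂ ⊔ H₃ = ⊤ ∨ ∃ h : G.Adj x y, H₁ ⊔ H₂ ⊔ H₃ ⊔ G.subgraphOfAdj h = ⊤)

theorem Att.union {A B : Set V} {x y : V} (hA : Att G A x y) (hB : Att G B x y) : Att G (A ∪ B) x y := by
  refine ⟨hA.ne, hA.non.inl, ?_, ?_, ?_⟩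
  · rintro (h | h)
    · exact hA.hx h
    · exact hB.hx h
  · rintro (h | h)
    · exact hA.hy h
    · exact hB.hy h
  · rintro u (hu | hu) w huw
    · rcases hA.nb u hu w huw with h | h
      · exact Or.inl (Or.inl h)
      · exact Or.inr h
    · rcases hB.nb u hu w huw with h | h
      · exact Or.inl (Or.inr h)
      · exact Or.inr h

/-- In a `K_{2,4}`-minor-free block, a part beside two further parts is good. -/
theorem good_of_three (hG : IsBlock G) (hm : MinorFree K24 G) {A B C : Set V} {x y : V}
    (hA : Att G A x y) (hB : Att G B x y) (hC : Att G C x y) (hAB : ∀ v, v ∈ A → v ∉ B)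
    (hAC : ∀ v, v ∈ A → v ∉ C) (hBC : ∀ v, v ∈ B → v ∉ C) : ¬ RK22 G (insert x (insert y A)) x y := by
  intro h
  refine hm (rk_minor (B := B ∪ C) ?_ hA.hx hA.hy ?_ ?_ h
    (Att.rk_of_split hG hB hC Set.subset_union_left Set.subset_union_right hBC))
  · rintro v hv (h | h)
    · exact hAB v hv h
    · exact hAC v hv h
  · exact (hB.union hC).hx
  · exact (hB.union hC).hy

theorem three_le_ncard [Finite V] {A : Set V} {x y : V} (hA : Att G A x y) :
    3 ≤ (insert x (insert y A)).ncard := by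
  obtain ⟨a, ha⟩ := hA.non
  have hax : x ≠ a := fun h => hA.hx (h ▸ ha)
  have hay : y ≠ a := fun h => hA.hy (h ▸ ha)
  have : ({x, y, a} : Set V).ncard = 3 := Set.ncard_eq_three.2 ⟨x, y, a, hA.ne, hax, hay, rfl⟩
  rw [← this]
  refine Set.ncard_le_ncard ?_ (Set.toFinite _)
  rintro v (h | h | h)
  · exact Or.inl h
  · exact Or.inr (Or.inl h)
  · exact Or.inr (Or.inr (by rw [show v = a from h]; exact ha))

theorem cap_pair {A B : Set V} {x y : V} (hAB : ∀ v, v ∈ A → v ∉ B) :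
    insert x (insert y A) ∩ insert x (insert y B) = {x, y} := by
  ext v
  simp only [Set.mem_inter_iff, Set.mem_insert_iff, Set.mem_singleton_iff]
  have := hAB v
  tauto

/-- Three parts give condition (ii). -/
theorem condII_of_three [Finite V] (hG : IsBlock G) (hm : MinorFree K24 G) {A B C : Set V} {x y : V}
    (hA : Att G A x y) (hB : Att G B x y) (hC : Att G C x y) (hAB : ∀ v, v ∈ A → v ∉ B)
    (hAC : ∀ v, v ∈ A → v ∉ C) (hBC : ∀ v, v ∈ B → v ∉ C)
    (hcov : ∀ v, v = x ∨ v = y ∨ v ∈ A ∨ v ∈ B ∨ v ∈ C) : CondII G := by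
  have gA := good_of_three hG hm hA hB hC hAB hAC hBC
  have gB := good_of_three hG hm hB hA hC (fun v h h' => hAB v h' h) hBC hAC
  have gC := good_of_three hG hm hC hA hB (fun v h h' => hAC v h' h) (fun v h h' => hBC v h' h) hAB
  obtain ⟨_, _, lA⟩ := hA.ol hG gA
  obtain ⟨_, _, lB⟩ := hB.ol hG gB
  obtain ⟨_, _, lC⟩ := hC.ol hG gC
  refine ⟨x, y, hA.ne, ind G (insert x (insert y A)), ind G (insert x (insert y B)),
    ind G (insert x (insert y C)), lA.ind.to_xy, lB.ind.to_xy, lC.ind.to_xy, three_le_ncard hA,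
    three_le_ncard hB, three_le_ncard hC, cap_pair hAB, cap_pair hAC, cap_pair hBC, Or.inl ?_⟩
  have key : ∀ {A : Set V}, Att G A x y → ∀ u v, G.Adj u v → u ∈ A → (ind G (insert x (insert y A))).Adj u v := by
    intro A hA u v huv hu
    rw [ind_adj]
    refine ⟨Or.inr (Or.inr hu), ?_, huv⟩
    rcases hA.nb u hu v huv with h | h | h
    · exact Or.inr (Or.inr h)
    · exact Or.inl h
    · exact Or.inr (Or.inl h)
  have hall : ∀ u v, G.Adj u v → (ind G (insert x (insert y A)) ⊔ ind G (insert x (insert y B)) ⊔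
      ind G (insert x (insert y C))).Adj u v := by
    intro u v huv
    simp only [SimpleGraph.Subgraph.sup_adj]
    have hu : u ∈ A ∨ u ∈ B ∨ u ∈ C ∨ u = x ∨ u = y := by have := hcov u; tauto
    have hv : v ∈ A ∨ v ∈ B ∨ v ∈ C ∨ v = x ∨ v = y := by have := hcov v; tauto
    rcases hu with hu | hu | hu | hu
    · exact Or.inl (Or.inl (key hA u v huv hu))
    · exact Or.inl (Or.inr (key hB u v huv hu))
    · exact Or.inr (key hC u v huv hu)
    · rcases hv with hv | hv | hv | hv
      · exact Or.inl (Or.inl (key hA v u huv.symm hv).symm)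
      · exact Or.inl (Or.inr (key hB v u huv.symm hv).symm)
      · exact Or.inr (key hC v u huv.symm hv).symm
      · refine Or.inl (Or.inl ?_)
        rw [ind_adj]
        simp only [Set.mem_insert_iff]
        exact ⟨by tauto, by tauto, huv⟩
  refine SimpleGraph.Subgraph.ext ?_ ?_
  · ext v
    simp only [SimpleGraph.Subgraph.verts_sup, SimpleGraph.Subgraph.verts_top, Set.mem_univ, iff_true,
      SimpleGraph.Subgraph.induce_verts, Set.mem_union, Set.mem_insert_iff]
    have := hcov v
    tauto
  · ext u v
    exact ⟨fun h => h.adj_sub, fun h => hall u v h⟩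

theorem condI_of_small [Finite V] (S : Finset V) (hS : ∀ u v, G.Adj u v → u ∈ S) (hc : S.card ≤ 3) : CondI G :=
  ⟨not_isMinor_of_card nice_K4.noniso S hS (by simp; omega), not_isMinor_of_card nice_K23.noniso S hS (by simp; omega)⟩

theorem condI_of_red {G' : SimpleGraph V} (h : CondI G')
    (hr : ∀ {W : Type} (H : SimpleGraph W), Nice H → IsMinor H G → IsMinor H G') : CondI G :=
  ⟨fun h' => h.1 (hr _ nice_K4 h'), fun h' => h.2 (hr _ nice_K23 h')⟩

theorem condI_of_one [Finite V] (hG : IsBlock G) {A : Set V} {x y : V} (hA : Att G A x y)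
    (hR : ¬ RK22 G (insert x (insert y A)) x y) (hcov : ∀ v, v = x ∨ v = y ∨ v ∈ A) : CondI G := by
  classical
  obtain ⟨n, u, l⟩ := hA.ol hG hR
  obtain ⟨a, ha⟩ := hA.non
  obtain ⟨h, -, -, -, hr⟩ := l.reduce (fun s t _ => hcov s) hA.ne ⟨a, Or.inr (Or.inr ha),
    fun h => hA.hx (h ▸ ha), fun h => hA.hy (h ▸ ha)⟩
  refine condI_of_red (G' := ⊥ ⊔ P3 x h y) ?_ fun H hH hm =>
    hr ⊥ (fun v _ _ _ t h => h) H hH (by rwa [bot_sup_eq])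
  refine condI_of_small {x, h, y} ?_ Finset.card_le_three
  intro s t hst
  rw [bot_sup_eq, P3_adj] at hst
  rcases hst.2 with ⟨h, -⟩ | ⟨h, -⟩ | ⟨h, -⟩ | ⟨h, -⟩ <;> simp [h]

theorem condI_C4 [Finite V] {x y h k : V} (hxy : x ≠ y) (hhx : h ≠ x) (hhy : h ≠ y) (hkx : k ≠ x) (hky : k ≠ y)
    (hhk : h ≠ k) : CondI (P3 x h y ⊔ P3 x k y) := by
  classical
  set Γ := P3 x h y ⊔ P3 x k y with hΓ
  have aΓ : ∀ s t, Γ.Adj s t ↔ (s ≠ t ∧ ((s = x ∧ t = h) ∨ (s = h ∧ t = x) ∨ (s = h ∧ t = y) ∨ (s = y ∧ t = h))) ∨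
      (s ≠ t ∧ ((s = x ∧ t = k) ∨ (s = k ∧ t = x) ∨ (s = k ∧ t = y) ∨ (s = y ∧ t = k))) := by
    intro s t
    rw [hΓ, SimpleGraph.sup_adj, P3_adj, P3_adj]
  refine condI_of_red (G' := supp Γ h y x) ?_ ?_
  · refine condI_of_small {x, y, k} ?_ Finset.card_le_three
    rintro s t ⟨h0, h1⟩
    simp only [Finset.mem_insert, Finset.mem_singleton]
    rcases h1 with ⟨h1, h2, h3⟩ | h1 | h1
    · rcases (aΓ s t).1 h1 with ⟨-, h1⟩ | ⟨-, h1⟩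
      · rcases h1 with ⟨h, h'⟩ | ⟨h, h'⟩ | ⟨h, h'⟩ | ⟨h, h'⟩ <;> first | exact absurd h h2 | exact absurd h' h3
      · rcases h1 with ⟨h, h'⟩ | ⟨h, h'⟩ | ⟨h, h'⟩ | ⟨h, h'⟩ <;> simp [h]
    · simp [h1.1]
    · simp [h1.1]
  · intro W H hH hm
    refine op2 hH (p := k) ?_ ?_ ?_ hhk.symm hxy ?_ ?_ hm
    · rw [aΓ]; exact Or.inl ⟨hhy, by simp⟩
    · rw [aΓ]; exact Or.inl ⟨hhx, by simp⟩
    · rw [aΓ]; exact Or.inr ⟨Ne.symm hky, by simp⟩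
    · intro v hv
      rcases (aΓ _ _).1 hv with ⟨-, h1⟩ | ⟨-, h1⟩
      · rcases h1 with ⟨e, e'⟩ | ⟨e, e'⟩ | ⟨e, e'⟩ | ⟨e, e'⟩ <;>
          first | exact Or.inl e' | exact Or.inr e' | contradiction
      · rcases h1 with ⟨e, e'⟩ | ⟨e, e'⟩ | ⟨e, e'⟩ | ⟨e, e'⟩ <;>
          first | exact Or.inl e' | exact Or.inr e' | contradiction
    · intro v hv
      rcases (aΓ _ _).1 hv with ⟨-, h1⟩ | ⟨-, h1⟩
      · rcases h1 with ⟨e, e'⟩ | ⟨e, e'⟩ | ⟨e, e'⟩ | ⟨e, e'⟩ <;>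
          first | exact Or.inl e' | exact Or.inr e' | exact absurd e.symm (by assumption)
      · rcases h1 with ⟨e, e'⟩ | ⟨e, e'⟩ | ⟨e, e'⟩ | ⟨e, e'⟩ <;>
          first | exact Or.inl e' | exact Or.inr e' | exact absurd e.symm (by assumption)

theorem condI_of_two [Finite V] (hG : IsBlock G) {A B : Set V} {x y : V} (hA : Att G A x y) (hB : Att G B x y)
    (hAB : ∀ v, v ∈ A → v ∉ B)
    (hRA : ¬ RK22 G (insert x (insert y A)) x y) (hRB : ¬ RK22 G (insert x (insert y B)) x y)
    (hcov : ∀ v, v = x ∨ v = y ∨ v ∈ A ∨ v ∈ B) : CondI G := by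
  classical
  obtain ⟨_, _, lA⟩ := hA.ol hG hRA
  obtain ⟨_, _, lB⟩ := hB.ol hG hRB
  obtain ⟨a, ha⟩ := hA.non
  obtain ⟨b, hb⟩ := hB.non
  obtain ⟨h, hh, hhx, hhy, hr⟩ := lA.ind.reduce (fun s t h => (ind_sc.1 h).1) hA.ne ⟨a, Or.inr (Or.inr ha),
    fun h => hA.hx (h ▸ ha), fun h => hA.hy (h ▸ ha)⟩
  obtain ⟨k, hk, hkx, hky, kr⟩ := lB.ind.reduce (fun s t h => (ind_sc.1 h).1) hA.ne ⟨b, Or.inr (Or.inr hb),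
    fun h => hB.hx (h ▸ hb), fun h => hB.hy (h ▸ hb)⟩
  have hhA : h ∈ A := by
    rcases hh with h1 | h1 | h1
    · exact absurd h1 hhx
    · exact absurd h1 hhy
    · exact h1
  have hkB : k ∈ B := by
    rcases hk with h1 | h1 | h1
    · exact absurd h1 hkx
    · exact absurd h1 hky
    · exact h1
  have hhk : h ≠ k := fun e => hAB h hhA (e ▸ hkB)
  have hxy := hA.ne
  set L1 := (ind G (insert x (insert y A))).spanningCoe
  set L2 := (ind G (insert x (insert y B))).spanningCoe
  have hle : G ≤ L2 ⊔ L1 := by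
    intro u v huv
    rw [SimpleGraph.sup_adj, ind_sc, ind_sc]
    have e1 : ∀ {C : Set V} {v}, v ∈ C → v ∈ insert x (insert y C) := fun h => Or.inr (Or.inr h)
    have e2 : ∀ {C : Set V} {v}, v = x ∨ v = y → v ∈ insert x (insert y C) := fun h => by
      rcases h with h | h
      · exact Or.inl h
      · exact Or.inr (Or.inl h)
    have e3 : ∀ {C : Set V} {v}, v ∈ C ∨ v = x ∨ v = y → v ∈ insert x (insert y C) := fun h =>
      h.elim e1 e2
    have hcov' : ∀ v, (v = x ∨ v = y) ∨ v ∈ A ∨ v ∈ B := fun v => or_assoc.2 (hcov v)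
    rcases hcov' u with h1 | h1 | h1
    · rcases hcov' v with h2 | h2 | h2
      · exact Or.inl ⟨e2 h1, e2 h2, huv⟩
      · exact Or.inr ⟨e2 h1, e1 h2, huv⟩
      · exact Or.inl ⟨e2 h1, e1 h2, huv⟩
    · exact Or.inr ⟨e1 h1, e3 (hA.nb u h1 v huv), huv⟩
    · exact Or.inl ⟨e1 h1, e3 (hB.nb u h1 v huv), huv⟩
  have nx : ∀ v ∈ insert x (insert y A), v ≠ x → v ≠ y → ∀ t, ¬ L2.Adj v t := by
    intro v hv hvx hvy t ht
    have := (ind_sc.1 ht).1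
    simp only [Set.mem_insert_iff, hvx, hvy, false_or] at hv this
    exact hAB v hv this
  have ny : ∀ v ∈ insert x (insert y B), v ≠ x → v ≠ y → ∀ t, ¬ (P3 x h y).Adj v t := by
    intro v hv hvx hvy t ht
    simp only [Set.mem_insert_iff, hvx, hvy, false_or] at hv
    rw [P3_adj] at ht
    have : v ≠ h := fun e => hAB h hhA (e ▸ hv)
    tauto
  refine condI_of_red (condI_C4 hxy hhx hhy hkx hky hhk) ?_
  intro W H hH hm
  have s1 := hr L2 nx H hH (hm.mono hle)
  exact kr (P3 x h y) ny H hH (s1.mono (by rw [sup_comm]))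

end TwoSep

open SimpleGraph

/-! ### Part 7: torsos -/

section Torso
variable {V : Type*} {G : SimpleGraph V}

/-- Every component outside `X` is an outerplanar piece attached at two vertices of `X`. -/
def TT (G : SimpleGraph V) (X : Set V) : Prop := ∀ D, IsComp G Xᶜ D → ∃ x y, x ∈ X ∧ y ∈ X ∧
  Att G D x y ∧ ¬ RK22 G (insert x (insert y D)) x y

theorem RK22.swapI {A : Set V} {x y : V} (h : RK22 G (insert x (insert y A)) x y) :
    RK22 G (insert y (insert x A)) y x := by
  rw [Set.insert_comm]; exact h.swap

theorem TT_univ : TT G Set.univ := by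
  rintro D ⟨h, hD, -⟩
  obtain ⟨a, ha⟩ := hD.1
  exact absurd trivial (h ha)

theorem TT.merge (hG : IsBlock G) {X A : Set V} {x y : V} (hT : TT G X) (hA : Att G A x y) (hx : x ∈ X)
    (hy : y ∈ X) (hR : ¬ RK22 G (insert x (insert y A)) x y) : TT G (X \ A) := by
  intro D hD
  have hAc := hA.conn hG hR
  have hAcl : Clo G (X \ A)ᶜ A := by
    intro u hu w hw huw
    rcases hA.nb u hu w huw with h | rfl | rfl
    · exact h
    · exact absurd ⟨hx, hA.hx⟩ hw
    · exact absurd ⟨hy, hA.hy⟩ hw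
  have hAcomp : IsComp G (X \ A)ᶜ A := ⟨fun v hv h => h.2 hv, hAc, hAcl⟩
  by_cases hm : ∃ a ∈ D, a ∈ A
  · rw [hD.eq_of_meet hAcomp hm]
    exact ⟨x, y, ⟨hx, hA.hx⟩, ⟨hy, hA.hy⟩, hA, hR⟩
  · push Not at hm
    have hDX : D ⊆ Xᶜ := fun v hv h => hD.1 hv ⟨h, hm v hv⟩
    obtain ⟨p, q, hp, hq, hat, hr⟩ := hT D ⟨hDX, hD.2.1, fun u hu w hw huw =>
      hD.2.2 u hu w (fun h => hw h.1) huw⟩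
    have key : ∀ p, p ∈ X → (∃ u ∈ D, G.Adj u p) → p ∉ A := by
      rintro p hp ⟨u, hu, hup⟩ hpA
      exact hm u hu (hAcl p hpA u (hD.1 hu) hup.symm)
    exact ⟨p, q, ⟨hp, key p hp (hat.adjx hG)⟩, ⟨hq, key q hq (hat.adjy hG)⟩, hat, hr⟩

theorem att_no {D R S : Set V} {p q y : V} (h : Att G D p q) (hS : S ⊆ D) (hR : Conn G R) (ht : Tch G S R)
    (hp : p ∉ R) (hq : q ∉ R) (hy : y ∈ R) (hyD : y ∉ D) : False := by
  obtain ⟨a, ha, b, hb, hab⟩ := ht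
  have key : ∀ u ∈ D, ∀ w ∈ R, G.Adj u w → w ∈ D := by
    intro u hu w hw huw
    rcases h.nb u hu w huw with h | rfl | rfl
    · exact h
    · exact absurd hw hp
    · exact absurd hw hq
  exact hyD (hR.sub D ⟨b, hb, key a (hS ha) b hb hab⟩ (fun u _ w hw huw hu => key u hu w hw huw) hy)

/-- The complement of an attached set is attached. -/
theorem Att.compl {D : Set V} {x y : V} (h : Att G D x y) (hn : ∃ v, v ∉ D ∧ v ≠ x ∧ v ≠ y) :
    Att G {v | v ∉ D ∧ v ≠ x ∧ v ≠ y} x y := by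
  refine ⟨h.ne, hn, fun h => h.2.1 rfl, fun h => h.2.2 rfl, fun u hu w huw => ?_⟩
  by_cases h1 : w = x
  · exact Or.inr (Or.inl h1)
  by_cases h2 : w = y
  · exact Or.inr (Or.inr h2)
  refine Or.inl ⟨fun hw => ?_, h1, h2⟩
  rcases h.nb w hw u huw.symm with h3 | h3 | h3
  · exact hu.1 h3
  · exact hu.2.1 h3
  · exact hu.2.2 h3

/-- Two disjoint attached sets and a further vertex give condition (ii). -/
theorem condII_of_two [Finite V] (hG : IsBlock G) (hm : MinorFree K24 G) {A B : Set V} {x y : V}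
    (hA : Att G A x y) (hB : Att G B x y) (hAB : ∀ v, v ∈ A → v ∉ B)
    (hz : ∃ v, v ∉ A ∧ v ∉ B ∧ v ≠ x ∧ v ≠ y) : CondII G := by
  obtain ⟨z, h1, h2, h3, h4⟩ := hz
  refine condII_of_three hG hm hA hB ((hA.union hB).compl ⟨z, ?_, h3, h4⟩) hAB ?_ ?_ ?_
  · rintro (h | h)
    · exact h1 h
    · exact h2 h
  · rintro v hv ⟨h, -⟩; exact h (Or.inl hv)
  · rintro v hv ⟨h, -⟩; exact h (Or.inr hv)
  · intro v
    simp only [Set.mem_setOf_eq, Set.mem_union]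
    tauto

section Three
theorem three_pairs [Finite V] (hG : IsBlock G) (hm : MinorFree K24 G) (hII : ¬ CondII G) {X D : Set V} {x y z : V}
    (hT : TT G X) (hX : ∀ v, v ∈ X ↔ v = x ∨ v = y ∨ v = z) (hzx : z ≠ x) (hzy : z ≠ y)
    (hD : IsComp G Xᶜ D) (aD : Att G D x y)
    {D' : Set V} (hD' : IsComp G Xᶜ D') (hne : ∃ v ∈ D', v ∉ D) :
    (Att G D' z x ∧ ¬ RK22 G (insert z (insert x D')) z x) ∨
    (Att G D' z y ∧ ¬ RK22 G (insert z (insert y D')) z y) := by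
  have hzX : z ∈ X := (hX z).2 (Or.inr (Or.inr rfl))
  have hbad : ¬ Att G D' x y := by
    intro ha
    refine hII (condII_of_two hG hm aD ha ?_ ⟨z, fun h => hD.1 h hzX, fun h => hD'.1 h hzX, hzx, hzy⟩)
    intro v hv hv'
    obtain ⟨w, hw, hw'⟩ := hne
    rw [hD.eq_of_meet hD' ⟨v, hv, hv'⟩] at hw'
    exact hw' hw
  obtain ⟨p, q, hp, hq, ha, hr⟩ := hT D' hD'
  rcases (hX p).1 hp with rfl | rfl | rfl <;> rcases (hX q).1 hq with rfl | rfl | rfl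
  · exact absurd rfl ha.ne
  · exact absurd ha hbad
  · exact Or.inl ⟨ha.swap, fun h => hr h.swapI⟩
  · exact absurd ha.swap hbad
  · exact absurd rfl ha.ne
  · exact Or.inr ⟨ha.swap, fun h => hr h.swapI⟩
  · exact Or.inl ⟨ha, hr⟩
  · exact Or.inr ⟨ha, hr⟩
  · exact absurd rfl ha.ne

theorem three_case [Finite V] (hG : IsBlock G) (hm : MinorFree K24 G) (hII : ¬ CondII G) {X D : Set V} {x y z : V}
    (hT : TT G X) (hX : ∀ v, v ∈ X ↔ v = x ∨ v = y ∨ v = z) (hzx : z ≠ x) (hzy : z ≠ y)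
    (hD : IsComp G Xᶜ D) (aD : Att G D x y)
    {R1 R2 S1 S2 : Set V}
    (h : RK G (insert x (insert y {v | v ∉ D ∧ v ≠ x ∧ v ≠ y})) x y R1 R2 S1 S2) (hz : z ∈ R1) : False := by
  have hxX : x ∈ X := (hX x).2 (Or.inl rfl)
  have hyX : y ∈ X := (hX y).2 (Or.inr (Or.inl rfl))
  have hzX : z ∈ X := (hX z).2 (Or.inr (Or.inr rfl))
  have key : ∀ S S' : Set V, RK G (insert x (insert y {v | v ∉ D ∧ v ≠ x ∧ v ≠ y})) x y R1 R2 S S' →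
      ∃ D', IsComp G Xᶜ D' ∧ S ⊆ D' ∧ Att G D' z y ∧ ¬ RK22 G (insert z (insert y D')) z y := by
    intro S S' h
    have hS : ∀ v ∈ S, v ∈ Xᶜ ∧ v ∉ D := by
      intro v hv
      have h1 : v ≠ x := fun e => h.d11 x h.hx (e ▸ hv)
      have h2 : v ≠ y := fun e => h.d21 y h.hy (e ▸ hv)
      have h3 : v ≠ z := fun e => h.d11 z hz (e ▸ hv)
      refine ⟨fun h' => ?_, ?_⟩
      · rcases (hX v).1 h' with h | h | h <;> contradiction
      · rcases h.s1 hv with h' | h' | h'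
        · exact absurd h' h1
        · exact absurd h' h2
        · exact h'.1
    obtain ⟨s, hs⟩ := h.cs1.1
    obtain ⟨D', hD', hsD'⟩ := exists_comp (G := G) Xᶜ s (hS s hs).1
    have hSD : S ⊆ D' := h.cs1.sub_of_clo (fun v hv => (hS v hv).1) hD'.2.2 ⟨s, hs, hsD'⟩
    refine ⟨D', hD', hSD, ?_⟩
    rcases three_pairs hG hm hII hT hX hzx hzy hD aD hD' ⟨s, hsD', (hS s hs).2⟩ with ⟨ha, -⟩ | ha
    · exact (att_no ha hSD h.cr2 h.t12 (h.d12 z hz) (h.d12 x h.hx) h.hy (fun h' => hD'.1 h' hyX)).elim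
    · exact ha
  obtain ⟨D1, c1, s1, a1, g1⟩ := key S1 S2 h
  obtain ⟨D2, c2, s2, a2, g2⟩ := key S2 S1 h.swapS
  by_cases hmeet : ∃ v ∈ D1, v ∈ D2
  · obtain rfl := c1.eq_of_meet c2 hmeet
    have yR1 : y ∉ R1 := fun h' => h.d12 y h' h.hy
    have zR2 : z ∉ R2 := h.d12 z hz
    have k1 : ∀ u ∈ D1, ∀ w ∈ R1, G.Adj u w → w ∈ D1 ∨ w = z := by
      intro u hu w hw huw
      rcases a1.nb u hu w huw with h | h | h
      · exact Or.inl h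
      · exact Or.inr h
      · exact absurd (h ▸ hw) yR1
    have k2 : ∀ u ∈ D1, ∀ w ∈ R2, G.Adj u w → w ∈ D1 ∨ w = y := by
      intro u hu w hw huw
      rcases a1.nb u hu w huw with h | h | h
      · exact Or.inl h
      · exact absurd (h ▸ hw) zR2
      · exact Or.inr h
    have t1 : ∀ S, S ⊆ D1 → Tch G S R1 → Tch G S (R1 ∩ insert z D1) := by
      rintro S hS ⟨a, ha, b, hb, hab⟩
      exact ⟨a, ha, b, ⟨hb, (k1 a (hS ha) b hb hab).symm⟩, hab⟩
    have t2 : ∀ S, S ⊆ D1 → Tch G S R2 → Tch G S (R2 ∩ insert y D1) := by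
      rintro S hS ⟨a, ha, b, hb, hab⟩
      exact ⟨a, ha, b, ⟨hb, (k2 a (hS ha) b hb hab).symm⟩, hab⟩
    refine g1 ⟨R1 ∩ insert z D1, R2 ∩ insert y D1, S1, S2, ?_⟩
    refine ⟨fun v hv => ?_, fun v hv => Or.inr hv.2, fun v hv => Or.inr (Or.inr (s1 hv)),
      fun v hv => Or.inr (Or.inr (s2 hv)), fun v hv hv' => h.d12 v hv.1 hv'.1, h.ds12,
      fun v hv => h.d11 v hv.1, fun v hv => h.d1s v hv.1, fun v hv => h.d21 v hv.1, fun v hv => h.d22 v hv.1,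
      ⟨hz, Or.inl rfl⟩, ⟨h.hy, Or.inl rfl⟩, h.cr1.part z hz k1, h.cr2.part y h.hy k2, h.cs1, h.cs2,
      t1 _ s1 h.t11, t2 _ s1 h.t12, t1 _ s2 h.t21, t2 _ s2 h.t22⟩
    rcases hv.2 with h | h
    · exact Or.inl h
    · exact Or.inr (Or.inr h)
  · push Not at hmeet
    exact hII (condII_of_two hG hm a1 a2 hmeet ⟨x, fun h => c1.1 h hxX, fun h => c2.1 h hxX, hzx.symm, aD.ne⟩)

theorem three_case' [Finite V] (hG : IsBlock G) (hm : MinorFree K24 G) (hII : ¬ CondII G) {X D : Set V} {x y z : V}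
    (hT : TT G X) (hX : ∀ v, v ∈ X ↔ v = x ∨ v = y ∨ v = z) (hzx : z ≠ x) (hzy : z ≠ y)
    (hD : IsComp G Xᶜ D) (aD : Att G D x y)
    {R1 R2 S1 S2 : Set V}
    (h : RK G (insert x (insert y {v | v ∉ D ∧ v ≠ x ∧ v ≠ y})) x y R1 R2 S1 S2) (hz1 : z ∉ R1) (hz2 : z ∉ R2)
    (hzS : z ∉ S1) : False := by
  have hxX : x ∈ X := (hX x).2 (Or.inl rfl)
  have hyX : y ∈ X := (hX y).2 (Or.inr (Or.inl rfl))
  have hS : ∀ v ∈ S1, v ∈ Xᶜ ∧ v ∉ D := by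
    intro v hv
    have h1 : v ≠ x := fun e => h.d11 x h.hx (e ▸ hv)
    have h2 : v ≠ y := fun e => h.d21 y h.hy (e ▸ hv)
    have h3 : v ≠ z := fun e => hzS (e ▸ hv)
    refine ⟨fun h' => ?_, ?_⟩
    · rcases (hX v).1 h' with h | h | h <;> contradiction
    · rcases h.s1 hv with h' | h' | h'
      · exact absurd h' h1
      · exact absurd h' h2
      · exact h'.1
  obtain ⟨s, hs⟩ := h.cs1.1
  obtain ⟨D', hD', hsD'⟩ := exists_comp (G := G) Xᶜ s (hS s hs).1
  have hSD : S1 ⊆ D' := h.cs1.sub_of_clo (fun v hv => (hS v hv).1) hD'.2.2 ⟨s, hs, hsD'⟩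
  rcases three_pairs hG hm hII hT hX hzx hzy hD aD hD' ⟨s, hsD', (hS s hs).2⟩ with ⟨ha, -⟩ | ⟨ha, -⟩
  · exact att_no ha hSD h.cr2 h.t12 hz2 (h.d12 x h.hx) h.hy (fun h' => hD'.1 h' hyX)
  · exact att_no ha hSD h.cr1 h.t11 hz1 (fun h' => h.d12 y h' h.hy) h.hx (fun h' => hD'.1 h' hxX)

end Three

theorem TT.four_le [Fintype V] (hG : IsBlock G) (hm : MinorFree K24 G) (hI : ¬ CondI G) (hII : ¬ CondII G)
    {X : Set V} (hT : TT G X) : 4 ≤ X.ncard := by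
  by_contra hlt
  have hlt : X.ncard ≤ 3 := by omega
  by_cases hXu : X = Set.univ
  · refine hI (condI_of_small Finset.univ (fun _ _ _ => Finset.mem_univ _) ?_)
    rw [hXu, Set.ncard_univ, Nat.card_eq_fintype_card] at hlt
    exact hlt
  obtain ⟨d, hd⟩ := (Set.ne_univ_iff_exists_notMem X).1 hXu
  obtain ⟨D, hD, hdD⟩ := exists_comp (G := G) Xᶜ d hd
  obtain ⟨x, y, hx, hy, aD, gD⟩ := hT D hD
  by_cases hB : ∃ v, v ∉ D ∧ v ≠ x ∧ v ≠ y
  swap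
  · push Not at hB
    exact hI (condI_of_one hG aD gD fun v => by have := hB v; tauto)
  set B := {v | v ∉ D ∧ v ≠ x ∧ v ≠ y} with hBdef
  have aB : Att G B x y := aD.compl hB
  have hdis : ∀ v, v ∈ D → v ∉ B := fun v hv hv' => hv'.1 hv
  by_cases hR : RK22 G (insert x (insert y B)) x y
  swap
  · refine hI (condI_of_two hG aD aB hdis gD hR ?_)
    intro v
    simp only [hBdef, Set.mem_setOf_eq]
    tauto
  by_cases hX2 : ∀ v ∈ X, v = x ∨ v = y
  · have hBX : B ⊆ Xᶜ := fun v hv h => by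
      rcases hX2 v h with h | h
      · exact hv.2.1 h
      · exact hv.2.2 h
    have hBc : Conn G B := by
      refine ⟨aB.non, fun P hPB hPn hcl v hv => ?_⟩
      by_contra hvP
      exact hII (condII_of_two hG hm aD (aB.part hPB hPn hcl) (fun v h h' => hdis v h (hPB h'))
        ⟨v, hv.1, hvP, hv.2⟩)
    obtain ⟨p, q, hp, hq, ha, hr⟩ := hT B ⟨hBX, hBc, fun u hu w hw huw => by
      rcases aB.nb u hu w huw with h | h | h
      · exact h
      · exact absurd (h ▸ hx) hw
      · exact absurd (h ▸ hy) hw⟩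
    rcases hX2 p hp with rfl | rfl <;> rcases hX2 q hq with rfl | rfl
    · exact ha.ne rfl
    · exact hr hR
    · exact hr hR.swapI
    · exact ha.ne rfl
  · push Not at hX2
    obtain ⟨z, hz, hzx, hzy⟩ := hX2
    have hX : ∀ v, v ∈ X ↔ v = x ∨ v = y ∨ v = z := by
      have hsub : ({x, y, z} : Set V) ⊆ X := by
        rintro v (h | h | h)
        · exact h ▸ hx
        · exact h ▸ hy
        · exact (show v = z from h) ▸ hz
      have h3 : ({x, y, z} : Set V).ncard = 3 :=
        Set.ncard_eq_three.2 ⟨x, y, z, aD.ne, hzx.symm, hzy.symm, rfl⟩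
      have := Set.eq_of_subset_of_ncard_le hsub (by rw [h3]; exact hlt) (Set.toFinite _)
      intro v
      rw [← this]; rfl
    have hX' : ∀ v, v ∈ X ↔ v = y ∨ v = x ∨ v = z := fun v => by rw [hX]; tauto
    obtain ⟨R1, R2, S1, S2, h⟩ := hR
    by_cases h1 : z ∈ R1
    · exact three_case hG hm hII hT hX hzx hzy hD aD h h1
    by_cases h2 : z ∈ R2
    · refine three_case hG hm hII hT hX' hzy hzx hD aD.swap (R1 := R2) (R2 := R1) (S1 := S1) (S2 := S2) ?_ h2
      have hBe : {v | v ∉ D ∧ v ≠ y ∧ v ≠ x} = B := by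
        ext v
        simp only [hBdef, Set.mem_setOf_eq]
        tauto
      rw [hBe, Set.insert_comm]
      exact h.swap
    by_cases h3 : z ∈ S1
    · exact three_case' hG hm hII hT hX hzx hzy hD aD h.swapS h1 h2 (h.ds12 z h3)
    · exact three_case' hG hm hII hT hX hzx hzy hD aD h h1 h2 h3

end Torso

open SimpleGraph

/-! ### Part 8: assembling condition (iii) -/

section Assemble
variable {V : Type*} {G : SimpleGraph V}

/-- Adjacency in the torso of `X`. -/
def TA (G : SimpleGraph V) (X : Set V) (a b : V) : Prop := a ≠ b ∧ (G.Adj a b ∨ ∃ D, IsComp G Xᶜ D ∧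
  (∃ u ∈ D, G.Adj u a) ∧ (∃ u ∈ D, G.Adj u b))

theorem TA.symm {X : Set V} {a b : V} (h : TA G X a b) : TA G X b a := by
  obtain ⟨h1, h2 | ⟨D, h2, h3, h4⟩⟩ := h
  · exact ⟨h1.symm, Or.inl h2.symm⟩
  · exact ⟨h1.symm, Or.inr ⟨D, h2, h4, h3⟩⟩

theorem no_sep2 [Finite V] (hG : IsBlock G) (hm : MinorFree K24 G) {X : Set V} (hT : TT G X)
    (hmin : ∀ Y, TT G Y → X.ncard ≤ Y.ncard) {x y : V} (hx : x ∈ X) (hy : y ∈ X) (hxy : x ≠ y)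
    {P : Set V} (hPX : P ⊆ X) (hPx : x ∉ P) (hPy : y ∉ P) (hP : P.Nonempty)
    {q : V} (hqX : q ∈ X) (hqP : q ∉ P) (hqx : q ≠ x) (hqy : q ≠ y)
    (hcl : ∀ p ∈ P, ∀ w ∈ X, TA G X p w → w ∈ P ∨ w = x ∨ w = y) : False := by
  have hA : Att G (P ∪ {v | v ∉ X ∧ ∃ D, IsComp G Xᶜ D ∧ v ∈ D ∧ ∃ u ∈ D, ∃ p ∈ P, G.Adj u p}) x y := by
    refine ⟨hxy, hP.mono fun v h => Or.inl h, ?_, ?_, ?_⟩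
    · rintro (h | h)
      · exact hPx h
      · exact h.1 hx
    · rintro (h | h)
      · exact hPy h
      · exact h.1 hy
    · rintro u (hu | ⟨huX, D, hD, huD, t, htD, p, hp, htp⟩) w huw
      · by_cases hw : w ∈ X
        · rcases hcl u hu w hw ⟨huw.ne, Or.inl huw⟩ with h | h
          · exact Or.inl (Or.inl h)
          · exact Or.inr h
        · obtain ⟨D, hD, hwD⟩ := exists_comp (G := G) Xᶜ w hw
          exact Or.inl (Or.inr ⟨hw, D, hD, hwD, w, hwD, u, hu, huw.symm⟩)
      · by_cases hw : w ∈ X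
        · by_cases hpw : p = w
          · exact Or.inl (Or.inl (hpw ▸ hp))
          · rcases hcl p hp w hw ⟨hpw, Or.inr ⟨D, hD, ⟨t, htD, htp⟩, ⟨u, huD, huw⟩⟩⟩ with h | h
            · exact Or.inl (Or.inl h)
            · exact Or.inr h
        · exact Or.inl (Or.inr ⟨hw, D, hD, hD.2.2 u huD w hw huw, t, htD, p, hp, htp⟩)
  have hqA : q ∉ (P ∪ {v | v ∉ X ∧ ∃ D, IsComp G Xᶜ D ∧ v ∈ D ∧ ∃ u ∈ D, ∃ p ∈ P, G.Adj u p}) := by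
    rintro (h | h)
    · exact hqP h
    · exact h.1 hqX
  obtain ⟨p, hp⟩ := hP
  have hpA : p ∈ (P ∪ {v | v ∉ X ∧ ∃ D, IsComp G Xᶜ D ∧ v ∈ D ∧ ∃ u ∈ D, ∃ p ∈ P, G.Adj u p}) := Or.inl hp
  generalize (P ∪ {v | v ∉ X ∧ ∃ D, IsComp G Xᶜ D ∧ v ∈ D ∧ ∃ u ∈ D, ∃ p ∈ P, G.Adj u p}) = A at *
  have hB := hA.compl ⟨q, hqA, hqx, hqy⟩
  have key : ∀ C : Set V, Att G C x y → ∀ c ∈ X, c ∈ C → RK22 G (insert x (insert y C)) x y := by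
    intro C hC c hcX hcC
    by_contra hR
    have h1 := hmin _ (hT.merge hG hC hx hy hR)
    have h2 : (X \ C).ncard < X.ncard := Set.ncard_lt_ncard ⟨Set.sdiff_subset, fun h => (h hcX).2 hcC⟩
    omega
  refine hm (rk_minor ?_ hA.hx hA.hy hB.hx hB.hy (key A hA p (hPX hp) hpA)
    (key _ hB q hqX ⟨hqA, hqx, hqy⟩))
  rintro v hv ⟨h, -⟩
  exact h hv

theorem no_sep [Finite V] (hG : IsBlock G) (hm : MinorFree K24 G) {X : Set V} (hT : TT G X)
    (hmin : ∀ Y, TT G Y → X.ncard ≤ Y.ncard) (h4 : 4 ≤ X.ncard) {S : Set V} (hS : S ⊆ X) (hS3 : S.ncard < 3)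
    {P : Set V} (hPX : P ⊆ X) (hPS : ∀ p ∈ P, p ∉ S) (hP : P.Nonempty)
    {q : V} (hqX : q ∈ X) (hqP : q ∉ P) (hqS : q ∉ S)
    (hcl : ∀ p ∈ P, ∀ w ∈ X, TA G X p w → w ∈ P ∨ w ∈ S) : False := by
  obtain ⟨p, hp⟩ := hP
  have hpq : p ≠ q := fun h => hqP (h ▸ hp)
  have hc : 2 ≤ (X \ {p, q}).ncard := by
    have h1 := Set.ncard_sdiff_add_ncard_of_subset (s := {p, q}) (t := X) (by
      rintro v (rfl | rfl)
      · exact hPX hp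
      · exact hqX) (Set.toFinite _)
    have h2 := Set.ncard_pair hpq
    omega
  obtain ⟨T, hST, hTX, hT2⟩ := Set.exists_subsuperset_card_eq (s := S) (t := X \ {p, q}) (n := 2) (by
    intro v hv
    refine ⟨hS hv, ?_⟩
    rintro (rfl | rfl)
    · exact hPS _ hp hv
    · exact hqS hv) (by omega) hc
  obtain ⟨x, y, hxy, rfl⟩ := Set.ncard_eq_two.1 hT2
  have hx := hTX (show x ∈ ({x, y} : Set V) from Or.inl rfl)
  have hy := hTX (show y ∈ ({x, y} : Set V) from Or.inr rfl)
  refine no_sep2 hG hm hT hmin hx.1 hy.1 hxy (P := P \ {x, y}) (q := q) (fun v hv => hPX hv.1)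
    (fun h => h.2 (Or.inl rfl)) (fun h => h.2 (Or.inr rfl)) ⟨p, hp, ?_⟩ hqX (fun h => hqP h.1) ?_ ?_ ?_
  · exact fun h => (hTX h).2 (Or.inl rfl)
  · rintro rfl; exact hx.2 (Or.inr rfl)
  · rintro rfl; exact hy.2 (Or.inr rfl)
  · intro p hp w hw hpw
    by_cases h : w ∈ ({x, y} : Set V)
    · exact Or.inr h
    · rcases hcl p hp.1 w hw hpw with h' | h'
      · exact Or.inl ⟨h', h⟩
      · exact absurd (hST h') h

def G0 (G : SimpleGraph V) (X : Set V) {n : ℕ} (φ : Fin n ↪ V) : SimpleGraph (Fin n) where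
  Adj a b := TA G X (φ a) (φ b)
  symm := ⟨fun _ _ h => h.symm⟩
  loopless := ⟨fun _ h => h.1 rfl⟩

theorem kconn [Finite V] (hG : IsBlock G) (hm : MinorFree K24 G) {X : Set V} (hT : TT G X)
    (hmin : ∀ Y, TT G Y → X.ncard ≤ Y.ncard) (h4 : 4 ≤ X.ncard) {n : ℕ} (φ : Fin n ↪ V)
    (hn : n = X.ncard) (hφ : ∀ v, v ∈ X ↔ ∃ a, φ a = v) : KConnected 3 (G0 G X φ) := by
  refine ⟨by simp; omega, fun S hS => ?_⟩
  rw [induce_connected_iff]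
  refine ⟨?_, ?_⟩
  · by_contra hne
    rw [Set.not_nonempty_iff_eq_empty, Set.compl_empty_iff] at hne
    subst hne
    rw [Set.ncard_univ, Nat.card_eq_fintype_card, Fintype.card_fin] at hS
    omega
  · rintro P hP ⟨p, hp⟩ hcl q hq
    by_contra hqP
    refine no_sep hG hm hT hmin h4 (S := φ '' S) (P := φ '' P) (q := φ q) ?_ ?_ ?_ ?_ ⟨φ p, p, hp, rfl⟩ ?_ ?_ ?_ ?_
    · rintro _ ⟨a, -, rfl⟩; exact (hφ _).2 ⟨a, rfl⟩
    · exact lt_of_le_of_lt (Set.ncard_image_le (Set.toFinite _)) hS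
    · rintro _ ⟨a, -, rfl⟩; exact (hφ _).2 ⟨a, rfl⟩
    · rintro _ ⟨a, ha, rfl⟩ ⟨b, hb, hab⟩
      cases φ.injective hab
      exact hP ha hb
    · exact (hφ _).2 ⟨q, rfl⟩
    · rintro ⟨b, hb, hab⟩
      cases φ.injective hab
      exact hqP hb
    · rintro ⟨b, hb, hab⟩
      cases φ.injective hab
      exact hq hb
    · rintro _ ⟨a, ha, rfl⟩ w hw haw
      obtain ⟨b, rfl⟩ := (hφ w).1 hw
      by_cases hb : b ∈ S
      · exact Or.inr ⟨b, hb, rfl⟩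
      · exact Or.inl ⟨b, hcl a ha b hb haw, rfl⟩

theorem assemble [Finite V] (hG : IsBlock G) (hm : MinorFree K24 G) (hII : ¬ CondII G) {X : Set V}
    (h4 : 4 ≤ X.ncard) {n : ℕ} (φ : Fin n ↪ V) (hφ : ∀ v, v ∈ X ↔ ∃ a, φ a = v)
    {k : ℕ} (D : Fin k → Set V) (xx yy : Fin k → Fin n)
    (hD : ∀ i, IsComp G Xᶜ (D i)) (hDa : ∀ K, IsComp G Xᶜ K → ∃ i, D i = K) (hDi : Function.Injective D)
    (hA : ∀ i, Att G (D i) (φ (xx i)) (φ (yy i)))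
    (hR : ∀ i, ¬ RK22 G (insert (φ (xx i)) (insert (φ (yy i)) (D i))) (φ (xx i)) (φ (yy i)))
    (hk : KConnected 3 (G0 G X φ)) :
    ∃ (V₀ : Type) (_ : Fintype V₀) (G₀ : SimpleGraph V₀) (k : ℕ)
          (xx yy : Fin k → V₀) (φ : V₀ ↪ V) (H : Fin k → G.Subgraph),
        KConnected 3 G₀ ∧ MinorFree K24 G₀ ∧
        (∀ i, G₀.Adj (xx i) (yy i)) ∧
        Function.Injective (fun i => s(xx i, yy i)) ∧
        Subdividable G₀ {e | ∃ i, e = s(xx i, yy i)} ∧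
        (∀ i, XYOuterplanar (H i).spanningCoe (H i).verts (φ (xx i)) (φ (yy i))) ∧
        (∀ i, (H i).verts ∩ Set.range φ = {φ (xx i), φ (yy i)}) ∧
        (∀ i j, i ≠ j → (H i).verts ∩ (H j).verts ⊆ Set.range φ) ∧
        (Set.range φ ∪ ⋃ i, (H i).verts) = Set.univ ∧
        (∀ u v : V, G.Adj u v ↔
          ((∃ a b : V₀, u = φ a ∧ v = φ b ∧ G₀.Adj a b ∧
              ∀ i, s(a, b) ≠ s(xx i, yy i)) ∨
           (∃ i, (H i).Adj u v))) := by
  have hφX : ∀ a, φ a ∈ X := fun a => (hφ _).2 ⟨a, rfl⟩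
  have hφD : ∀ a i, φ a ∉ D i := fun a i h => (hD i).1 h (hφX a)
  have hdis : ∀ i j v, v ∈ D i → v ∈ D j → i = j := fun i j v h h' =>
    hDi ((hD i).eq_of_meet (hD j) ⟨v, h, h'⟩)
  have hpair : ∀ i, (G0 G X φ).Adj (xx i) (yy i) := fun i =>
    ⟨(hA i).ne, Or.inr ⟨D i, hD i, (hA i).adjx hG, (hA i).adjy hG⟩⟩
  have hadj : ∀ a b, (G0 G X φ).Adj a b → G.Adj (φ a) (φ b) ∨ ∃ i, s(a, b) = s(xx i, yy i) := by
    rintro a b ⟨hne, h | ⟨K, hK, ⟨u, hu, hua⟩, ⟨w, hw, hwb⟩⟩⟩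
    · exact Or.inl h
    · obtain ⟨i, rfl⟩ := hDa K hK
      refine Or.inr ⟨i, ?_⟩
      have hne' : a ≠ b := fun h => hne (h ▸ rfl)
      have h1 := (hA i).nb u hu _ hua
      have h2 := (hA i).nb w hw _ hwb
      simp only [hφD, false_or, φ.injective.eq_iff] at h1 h2
      rw [Sym2.eq_iff]
      rcases h1 with h1 | h1 <;> rcases h2 with h2 | h2
      · exact absurd (h1.trans h2.symm) hne'
      · exact Or.inl ⟨h1, h2⟩
      · exact Or.inr ⟨h1, h2⟩
      · exact absurd (h1.trans h2.symm) hne'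
  have hthird : ∀ a b : V, ∃ v ∈ X, v ≠ a ∧ v ≠ b := by
    intro a b
    by_contra hn
    push Not at hn
    have : X ⊆ {a, b} := fun v hv => by
      by_cases h : v = a
      · exact Or.inl h
      · exact Or.inr (hn v hv h)
    have h1 := Set.ncard_le_ncard this (Set.toFinite _)
    have h2 := Set.ncard_insert_le a {b}
    rw [Set.ncard_singleton] at h2
    omega
  have hinj : Function.Injective (fun i => s(xx i, yy i)) := by
    intro i j hij
    by_contra hne
    have haj : Att G (D j) (φ (xx i)) (φ (yy i)) := by
      rcases Sym2.eq_iff.1 hij with ⟨h1, h2⟩ | ⟨h1, h2⟩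
      · rw [h1, h2]; exact hA j
      · rw [h1, h2]; exact (hA j).swap
    obtain ⟨v, hvX, h1, h2⟩ := hthird (φ (xx i)) (φ (yy i))
    exact hII (condII_of_two hG hm (hA i) haj (fun v h h' => hne (hdis i j v h h'))
      ⟨v, fun h => (hD i).1 h hvX, fun h => (hD j).1 h hvX, h1, h2⟩)
  refine ⟨Fin n, inferInstance, G0 G X φ, k, xx, yy, φ,
    fun i => ind G (insert (φ (xx i)) (insert (φ (yy i)) (D i))), hk, ?_, hpair, hinj, ⟨?_, ?_⟩, ?_, ?_, ?_, ?_, ?_⟩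
  · intro hmin
    refine hm (hmin.trans' nice_K24.noniso (fun a => {v | v = φ a ∨ ∃ i, xx i = a ∧ v ∈ D i}) ?_ ?_ ?_)
    · rintro a b v (rfl | ⟨i, hi, hv⟩) (h | ⟨j, hj, hv'⟩)
      · exact φ.injective h
      · exact absurd hv' (hφD _ _)
      · exact absurd (h ▸ hv) (hφD _ _)
      · rw [← hi, ← hj, hdis i j v hv hv']
    · intro a b _
      refine conn_of_base _ (φ a) (Or.inl rfl) ?_
      rintro P hP ⟨v, hv⟩ hcl
      rcases hP hv with rfl | ⟨i, rfl, hvi⟩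
      · exact hv
      · have hsub : D i ⊆ P := (hD i).2.1.sub P ⟨v, hvi, hv⟩ fun u _ w hw huw huP =>
          hcl u huP w (Or.inr ⟨i, rfl, hw⟩) huw
        obtain ⟨u, hu, hux⟩ := (hA i).adjx hG
        exact hcl u (hsub hu) _ (Or.inl rfl) hux
    · intro a b hab
      rcases hadj a b hab with h | ⟨i, hi⟩
      · exact ⟨φ a, Or.inl rfl, φ b, Or.inl rfl, h⟩
      · obtain ⟨u, hu, huy⟩ := (hA i).adjy hG
        rcases Sym2.eq_iff.1 hi with ⟨rfl, rfl⟩ | ⟨rfl, rfl⟩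
        · exact ⟨u, Or.inr ⟨i, rfl, hu⟩, _, Or.inl rfl, huy⟩
        · exact ⟨_, Or.inl rfl, u, Or.inr ⟨i, rfl, hu⟩, huy.symm⟩
  · rintro _ ⟨i, rfl⟩
    exact hpair i
  · intro hmin
    choose idx hidx using fun e : {e | ∃ i, e = s(xx i, yy i)} => e.2
    have hlr : ∀ a (e : {e | ∃ i, e = s(xx i, yy i)}), a ∈ (e : Sym2 (Fin n)) → Tch G {φ a} (D (idx e)) := by
      intro a e hae
      rw [hidx e, Sym2.mem_iff] at hae
      obtain ⟨u, hu, hux⟩ := (hA (idx e)).adjx hG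
      obtain ⟨w, hw, hwy⟩ := (hA (idx e)).adjy hG
      rcases hae with h | h
      · rw [h]; exact ⟨_, rfl, u, hu, hux.symm⟩
      · rw [h]; exact ⟨_, rfl, w, hw, hwy.symm⟩
    refine hm (hmin.trans' nice_K24.noniso (Sum.elim (fun a => {φ a}) (fun e => D (idx e))) ?_ ?_ ?_)
    · rintro (a | e) (b | f) v hv hv'
      · have h1 : v = φ a := hv
        have h2 : v = φ b := hv'
        rw [φ.injective (h1.symm.trans h2)]
      · have h1 : v = φ a := hv
        exact absurd (h1 ▸ hv') (hφD _ _)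
      · have h1 : v = φ b := hv'
        exact absurd (h1 ▸ hv) (hφD _ _)
      · have h := hdis _ _ v hv hv'
        have : e = f := Subtype.ext (by rw [hidx e, hidx f, h])
        rw [this]
    · rintro (a | e) b _
      · exact conn_singleton _
      · exact (hD _).2.1
    · rintro (a | e) (b | f) hab
      · rw [sub_adj_ll] at hab
        rcases hadj a b hab.1 with h | h
        · exact ⟨_, rfl, _, rfl, h⟩
        · exact absurd h hab.2
      · rw [sub_adj_lr] at hab
        exact hlr a f hab
      · have hab := hab.symm
        rw [sub_adj_lr] at hab
        exact (hlr b e hab).symm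
      · exact absurd hab sub_adj_rr
  · intro i
    obtain ⟨m, u, h⟩ := (hA i).ol hG (hR i)
    exact h.ind.to_xy
  · intro i
    ext v
    constructor
    · rintro ⟨h | h | h, a, rfl⟩
      · exact Or.inl h
      · exact Or.inr h
      · exact absurd h (hφD _ _)
    · rintro (rfl | rfl)
      · exact ⟨Or.inl rfl, _, rfl⟩
      · exact ⟨Or.inr (Or.inl rfl), _, rfl⟩
  · rintro i j hij v ⟨h | h | h, h' | h' | h'⟩
    any_goals exact ⟨_, h.symm⟩
    any_goals exact ⟨_, h'.symm⟩
    exact absurd (hdis i j v h h') hij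
  · rw [Set.eq_univ_iff_forall]
    intro v
    by_cases hv : v ∈ X
    · exact Or.inl ((hφ v).1 hv)
    · obtain ⟨K, hK, hvK⟩ := exists_comp (G := G) Xᶜ v hv
      obtain ⟨i, rfl⟩ := hDa K hK
      exact Or.inr (Set.mem_iUnion.2 ⟨i, Or.inr (Or.inr hvK)⟩)
  · have hin : ∀ i u v, u ∈ D i → G.Adj u v → v ∈ insert (φ (xx i)) (insert (φ (yy i)) (D i)) := by
      intro i u v hu huv
      rcases (hA i).nb u hu v huv with h | h | h
      · exact Or.inr (Or.inr h)
      · exact Or.inl h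
      · exact Or.inr (Or.inl h)
    have hout : ∀ u v, u ∉ X → G.Adj u v →
        ∃ i, (ind G (insert (φ (xx i)) (insert (φ (yy i)) (D i)))).Adj u v := by
      intro u v hu huv
      obtain ⟨K, hK, huK⟩ := exists_comp (G := G) Xᶜ u hu
      obtain ⟨i, rfl⟩ := hDa K hK
      exact ⟨i, ind_adj.2 ⟨Or.inr (Or.inr huK), hin i u v huK huv, huv⟩⟩
    intro u v
    constructor
    · intro huv
      by_cases hu : u ∈ X
      · by_cases hv : v ∈ X
        · obtain ⟨a, rfl⟩ := (hφ u).1 hu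
          obtain ⟨b, rfl⟩ := (hφ v).1 hv
          by_cases hp : ∃ i, s(a, b) = s(xx i, yy i)
          · obtain ⟨i, hi⟩ := hp
            refine Or.inr ⟨i, ind_adj.2 ?_⟩
            rcases Sym2.eq_iff.1 hi with ⟨rfl, rfl⟩ | ⟨rfl, rfl⟩
            · exact ⟨Or.inl rfl, Or.inr (Or.inl rfl), huv⟩
            · exact ⟨Or.inr (Or.inl rfl), Or.inl rfl, huv⟩
          · push Not at hp
            exact Or.inl ⟨a, b, rfl, rfl, ⟨huv.ne, Or.inl huv⟩, hp⟩
        · obtain ⟨i, hi⟩ := hout v u hv huv.symm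
          exact Or.inr ⟨i, hi.symm⟩
      · exact Or.inr (hout u v hu huv)
    · rintro (⟨a, b, rfl, rfl, hab, hn⟩ | ⟨i, hi⟩)
      · rcases hadj a b hab with h | ⟨i, hi⟩
        · exact h
        · exact absurd hi (hn i)
      · exact (ind_adj.1 hi).2.2

theorem condIII [Fintype V] (hG : IsBlock G) (hm : MinorFree K24 G) (hI : ¬ CondI G) (hII : ¬ CondII G) :
    ∃ (V₀ : Type) (_ : Fintype V₀) (G₀ : SimpleGraph V₀) (k : ℕ)
          (xx yy : Fin k → V₀) (φ : V₀ ↪ V) (H : Fin k → G.Subgraph),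
        KConnected 3 G₀ ∧ MinorFree K24 G₀ ∧
        (∀ i, G₀.Adj (xx i) (yy i)) ∧
        Function.Injective (fun i => s(xx i, yy i)) ∧
        Subdividable G₀ {e | ∃ i, e = s(xx i, yy i)} ∧
        (∀ i, XYOuterplanar (H i).spanningCoe (H i).verts (φ (xx i)) (φ (yy i))) ∧
        (∀ i, (H i).verts ∩ Set.range φ = {φ (xx i), φ (yy i)}) ∧
        (∀ i j, i ≠ j → (H i).verts ∩ (H j).verts ⊆ Set.range φ) ∧
        (Set.range φ ∪ ⋃ i, (H i).verts) = Set.univ ∧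
        (∀ u v : V, G.Adj u v ↔
          ((∃ a b : V₀, u = φ a ∧ v = φ b ∧ G₀.Adj a b ∧
              ∀ i, s(a, b) ≠ s(xx i, yy i)) ∨
           (∃ i, (H i).Adj u v))) := by
  obtain ⟨X, hT, hmin⟩ := exists_min (TT G) Set.ncard ⟨_, TT_univ⟩
  have h4 := hT.four_le hG hm hI hII
  let e := Finite.equivFin X
  let φ : Fin (Nat.card X) ↪ V := e.symm.toEmbedding.trans (Function.Embedding.subtype _)
  have hφ : ∀ v, v ∈ X ↔ ∃ a, φ a = v := by
    intro v
    constructor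
    · intro hv
      exact ⟨e ⟨v, hv⟩, by
        change (e.symm (e ⟨v, hv⟩)).1 = v
        rw [e.symm_apply_apply]⟩
    · rintro ⟨a, rfl⟩
      exact (e.symm a).2
  let d := Finite.equivFin {D : Set V // IsComp G Xᶜ D}
  have hc : ∀ i, ∃ a b, Att G (d.symm i).1 (φ a) (φ b) ∧
      ¬ RK22 G (insert (φ a) (insert (φ b) (d.symm i).1)) (φ a) (φ b) := by
    intro i
    obtain ⟨x, y, hx, hy, h1, h2⟩ := hT _ (d.symm i).2
    obtain ⟨a, rfl⟩ := (hφ x).1 hx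
    obtain ⟨b, rfl⟩ := (hφ y).1 hy
    exact ⟨a, b, h1, h2⟩
  choose xx yy hA hR using hc
  exact assemble hG hm hII h4 φ hφ (fun i => (d.symm i).1) xx yy (fun i => (d.symm i).2)
    (fun K hK => ⟨d ⟨K, hK⟩, by simp⟩) (Subtype.val_injective.comp d.symm.injective) hA hR
    (kconn hG hm hT hmin h4 φ rfl hφ)

end Assemble

/-- Theorem 19, characterization of `K_{2,4}`-minor-free blocks:
a block `G` is `K_{2,4}`-minor-free iff (i) `G` is outerplanar (no `K₄` minor and no
`K_{2,3}` minor), or (ii) `G` is the union of three `xy`-outerplanar graphs on at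
least three vertices, pairwise meeting exactly in `{x, y}`, and possibly the edge
`xy`, or (iii) `G` is obtained from a 3-connected `K_{2,4}`-minor-free graph `G₀` by
replacing each edge `xᵢyᵢ` of a subdividable set of edges by an `xᵢyᵢ`-outerplanar
graph `Hᵢ`, where `V(Hᵢ) ∩ V(G₀) = {xᵢ, yᵢ}` and `V(Hᵢ) ∩ V(Hⱼ) ⊆ V(G₀)` for
`i ≠ j`. -/
theorem block_K24MinorFree_iff {V : Type*} [Fintype V] (G : SimpleGraph V)
    (hG : IsBlock G) :
    MinorFree K24 G ↔
      ((MinorFree (completeGraph (Fin 4)) G ∧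
        MinorFree (completeBipartiteGraph (Fin 2) (Fin 3)) G) ∨
      (∃ x y : V, x ≠ y ∧ ∃ H₁ H₂ H₃ : G.Subgraph,
        XYOuterplanar H₁.spanningCoe H₁.verts x y ∧
        XYOuterplanar H₂.spanningCoe H₂.verts x y ∧
        XYOuterplanar H₃.spanningCoe H₃.verts x y ∧
        3 ≤ H₁.verts.ncard ∧ 3 ≤ H₂.verts.ncard ∧ 3 ≤ H₃.verts.ncard ∧
        H₁.verts ∩ H₂.verts = {x, y} ∧ H₁.verts ∩ H₃.verts = {x, y} ∧
        H₂.verts ∩ H₃.verts = {x, y} ∧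
        (H₁ ⊔ H₂ ⊔ H₃ = ⊤ ∨ ∃ h : G.Adj x y, H₁ ⊔ H₂ ⊔ H₃ ⊔ G.subgraphOfAdj h = ⊤)) ∨
      (∃ (V₀ : Type) (_ : Fintype V₀) (G₀ : SimpleGraph V₀) (k : ℕ)
          (xx yy : Fin k → V₀) (φ : V₀ ↪ V) (H : Fin k → G.Subgraph),
        KConnected 3 G₀ ∧ MinorFree K24 G₀ ∧
        (∀ i, G₀.Adj (xx i) (yy i)) ∧
        Function.Injective (fun i => s(xx i, yy i)) ∧
        Subdividable G₀ {e | ∃ i, e = s(xx i, yy i)} ∧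
        (∀ i, XYOuterplanar (H i).spanningCoe (H i).verts (φ (xx i)) (φ (yy i))) ∧
        (∀ i, (H i).verts ∩ Set.range φ = {φ (xx i), φ (yy i)}) ∧
        (∀ i j, i ≠ j → (H i).verts ∩ (H j).verts ⊆ Set.range φ) ∧
        (Set.range φ ∪ ⋃ i, (H i).verts) = Set.univ ∧
        (∀ u v : V, G.Adj u v ↔
          ((∃ a b : V₀, u = φ a ∧ v = φ b ∧ G₀.Adj a b ∧
              ∀ i, s(a, b) ≠ s(xx i, yy i)) ∨
           (∃ i, (H i).Adj u v))))) := by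
  constructor
  · intro hm
    by_cases hI : CondI G
    · exact Or.inl hI
    by_cases hII : CondII G
    · exact Or.inr (Or.inl hII)
    exact Or.inr (Or.inr (condIII hG hm hI hII))
  · rintro (⟨-, h⟩ | ⟨x, y, hxy, H₁, H₂, H₃, o1, o2, o3, c1, c2, c3, i12, i13, i23, hU⟩ |
      ⟨V₀, _, G₀, k, xx, yy, φ, H, -, -, hadj, hinj, hsub, ho, hran, hij, -, hGa⟩)
    · exact fun hm => h (K24_of_K23 hm)
    · exact suff_ii hxy H₁ H₂ H₃ o1 o2 o3 c1 c2 c3 i12 i13 i23 hU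
    · exact suff_iii V₀ G₀ k xx yy φ H hadj hinj hsub ho hran hij hGa

end K24Paper
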